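/- arXiv:1111.1592 — 3 statements merged into one kernel-verified Lean document; each statement's English description precedes it below -/
import Mathlib

section
/- (Row addition.) Let A be a square matrix over ℕ ∪ {∞} with no zeros on the diagonal, and let i ≠ j be indices such that A(i,j) ≠ 0 and row j of A contains no entry equal to ∞. Let A' be the matrix obtained from A by replacing each entry A(i,l) with A(i,l) + A(j,l) for l ≠ j, and replacing A(i,j) with A(i,j) + A(j,j) − 1, all other entries unchanged. Then A ∼_M A'. -/
/-- A directed graph as used in the theory of graph `C*`-algebras:
a type of vertices, a type of edges, and range and source maps. -/
structure CKGraph : Type 1 where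
  V : Type
  E : Type
  r : E → V
  s : E → V

namespace CKGraph

/-- An isomorphism of graphs: bijections of vertices and edges intertwining
the range and source maps. -/
structure Iso (G H : CKGraph) where
  vEquiv : G.V ≃ H.V
  eEquiv : G.E ≃ H.E
  map_r : ∀ e, H.r (eEquiv e) = vEquiv (G.r e)
  map_s : ∀ e, H.s (eEquiv e) = vEquiv (G.s e)

/-- A vertex is a source if it receives no edges. -/
def IsSource (G : CKGraph) (v : G.V) : Prop := ∀ e, G.r e ≠ v

/-- A vertex is a sink if it emits no edges. -/
def IsSink (G : CKGraph) (v : G.V) : Prop := ∀ e, G.s e ≠ v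

/-- A vertex is an infinite emitter if it emits infinitely many edges. -/
def IsInfiniteEmitter (G : CKGraph) (v : G.V) : Prop := {e | G.s e = v}.Infinite

/-- A vertex is regular if it is neither a sink nor an infinite emitter. -/
def Regular (G : CKGraph) (v : G.V) : Prop :=
  (∃ e, G.s e = v) ∧ {e | G.s e = v}.Finite

/-- There is a (nonempty) path from `u` to `v` in `G`. -/
inductive HasPath (G : CKGraph) : G.V → G.V → Prop
  | single (e : G.E) : HasPath G (G.s e) (G.r e)
  | cons (e : G.E) {v : G.V} : HasPath G (G.r e) v → HasPath G (G.s e) v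

/-- `G.Geq u v` is the relation `u ≥ v`: `u = v` or there is a path from `u` to `v`. -/
def Geq (G : CKGraph) (u v : G.V) : Prop := u = v ∨ G.HasPath u v

/-- There is a (nonempty) path from `u` to `v` all of whose vertices lie in `S`. -/
inductive HasPathIn (G : CKGraph) (S : Set G.V) : G.V → G.V → Prop
  | single (e : G.E) : G.s e ∈ S → G.r e ∈ S → HasPathIn G S (G.s e) (G.r e)
  | cons (e : G.E) {v : G.V} : G.s e ∈ S → HasPathIn G S (G.r e) v →
      HasPathIn G S (G.s e) v

/-- The nonempty list of edges `l` is a path from `u` to `v`. -/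
def IsPathFromTo (G : CKGraph) (l : List G.E) (u v : G.V) : Prop :=
  ∃ h : l ≠ [], l.Chain' (fun e f => G.r e = G.s f) ∧
    G.s (l.head h) = u ∧ G.r (l.getLast h) = v

/-- The list of edges `l` is a simple loop based at `v`: a loop at `v` such that the
range of every non-final edge is different from `v`. -/
def IsSimpleLoopAt (G : CKGraph) (v : G.V) (l : List G.E) : Prop :=
  G.IsPathFromTo l v v ∧ ∀ e ∈ l.dropLast, G.r e ≠ v

/-- A set of vertices is hereditary if it contains the range of every edge whose
source it contains. -/
def Hereditary (G : CKGraph) (H : Set G.V) : Prop := ∀ e, G.s e ∈ H → G.r e ∈ H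

/-- A set of vertices is saturated if it contains every regular vertex all of whose
emitted edges have range in the set. -/
def Saturated (G : CKGraph) (H : Set G.V) : Prop :=
  ∀ v, G.Regular v → (∀ e, G.s e = v → G.r e ∈ H) → v ∈ H

/-- Move (S): removing the (regular) source `v` together with all edges it emits. -/
def removeSource (G : CKGraph) (v : G.V) (hsrc : G.IsSource v) : CKGraph where
  V := {w : G.V // w ≠ v}
  E := {e : G.E // G.s e ≠ v}
  r e := ⟨G.r e.1, hsrc e.1⟩
  s e := ⟨G.s e.1, e.2⟩

/-- Move (R): the reduction at a vertex `u` that emits exactly one edge `f` with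
`r f ≠ u` and receives only from the single vertex `v`. -/
def reduce (G : CKGraph) (u : G.V) (f : G.E) (hf : G.s f = u) (hrf : G.r f ≠ u)
    (honly : ∀ e, G.s e = u → e = f) (v : G.V) (hin : ∀ e, G.r e = u → G.s e = v) :
    CKGraph where
  V := {w : G.V // w ≠ u}
  E := {e : G.E // G.r e ≠ u ∧ e ≠ f} ⊕ {e : G.E // G.r e = u}
  r x :=
    match x with
    | .inl e => ⟨G.r e.1, e.2.1⟩
    | .inr _ => ⟨G.r f, hrf⟩
  s x :=
    match x with
    | .inl e => ⟨G.s e.1, fun h => e.2.2 (honly e.1 h)⟩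
    | .inr e => ⟨G.s e.1, by
        intro h
        have h2 : G.r e.1 = u := e.2
        rw [honly e.1 h] at h2
        exact hrf h2⟩

/-- Move (O): the out-split of `G` at `v` according to the partition of `s⁻¹(v)`
into the fibres of `P`. -/
noncomputable def outSplit (G : CKGraph) (v : G.V) (n : ℕ)
    (P : {e : G.E // G.s e = v} → Fin n) : CKGraph :=
  letI := Classical.decEq G.V
  { V := {w : G.V // w ≠ v} ⊕ Fin n
    E := {e : G.E // G.r e ≠ v} ⊕ ({e : G.E // G.r e = v} × Fin n)
    r := fun x =>
      match x with
      | .inl e => Sum.inl ⟨G.r e.1, e.2⟩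
      | .inr p => Sum.inr p.2
    s := fun x =>
      match x with
      | .inl e =>
          if h : G.s e.1 = v then Sum.inr (P ⟨e.1, h⟩) else Sum.inl ⟨G.s e.1, h⟩
      | .inr p =>
          if h : G.s p.1.1 = v then Sum.inr (P ⟨p.1.1, h⟩)
          else Sum.inl ⟨G.s p.1.1, h⟩ }

/-- Move (I): the in-split of `G` at `v` according to the partition of `r⁻¹(v)`
into the fibres of `P`. -/
noncomputable def inSplit (G : CKGraph) (v : G.V) (n : ℕ)
    (P : {e : G.E // G.r e = v} → Fin n) : CKGraph :=
  letI := Classical.decEq G.V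
  { V := {w : G.V // w ≠ v} ⊕ Fin n
    E := {e : G.E // G.s e ≠ v} ⊕ ({e : G.E // G.s e = v} × Fin n)
    s := fun x =>
      match x with
      | .inl e => Sum.inl ⟨G.s e.1, e.2⟩
      | .inr p => Sum.inr p.2
    r := fun x =>
      match x with
      | .inl e =>
          if h : G.r e.1 = v then Sum.inr (P ⟨e.1, h⟩) else Sum.inl ⟨G.r e.1, h⟩
      | .inr p =>
          if h : G.r p.1.1 = v then Sum.inr (P ⟨p.1.1, h⟩)
          else Sum.inl ⟨G.r p.1.1, h⟩ }

/-- Move-equivalence: the smallest equivalence relation on graphs with finitely many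
vertices such that `G ∼ H` whenever `H` is obtained from `G`, up to graph
isomorphism, by one of the moves (S), (I), (O), (R). -/
inductive MoveEquiv : CKGraph → CKGraph → Prop
  | of_iso {G H : CKGraph} (hG : Finite G.V) (h : Nonempty (Iso G H)) : MoveEquiv G H
  | moveS {G : CKGraph} (hG : Finite G.V) (v : G.V) (hreg : G.Regular v)
      (hsrc : G.IsSource v) {H : CKGraph}
      (h : Nonempty (Iso H (G.removeSource v hsrc))) : MoveEquiv G H
  | moveR {G : CKGraph} (hG : Finite G.V) (u : G.V) (f : G.E) (hf : G.s f = u)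
      (hrf : G.r f ≠ u) (honly : ∀ e, G.s e = u → e = f) (v : G.V)
      (hin : ∀ e, G.r e = u → G.s e = v) {H : CKGraph}
      (h : Nonempty (Iso H (G.reduce u f hf hrf honly v hin))) : MoveEquiv G H
  | moveO {G : CKGraph} (hG : Finite G.V) (v : G.V) (hns : ¬ G.IsSink v) (n : ℕ)
      (P : {e : G.E // G.s e = v} → Fin n) (hsurj : Function.Surjective P)
      (hinf : ∀ i j : Fin n, {x : {e : G.E // G.s e = v} | P x = i}.Infinite →
        {x : {e : G.E // G.s e = v} | P x = j}.Infinite → i = j)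
      {H : CKGraph} (h : Nonempty (Iso H (G.outSplit v n P))) : MoveEquiv G H
  | moveI {G : CKGraph} (hG : Finite G.V) (v : G.V) (hreg : G.Regular v)
      (hns : ¬ G.IsSource v) (n : ℕ) (P : {e : G.E // G.r e = v} → Fin n)
      (hsurj : Function.Surjective P) {H : CKGraph}
      (h : Nonempty (Iso H (G.inSplit v n P))) : MoveEquiv G H
  | symm {G H : CKGraph} : MoveEquiv G H → MoveEquiv H G
  | trans {G H K : CKGraph} : MoveEquiv G H → MoveEquiv H K → MoveEquiv G K

/-- The graph obtained from `G` by collapsing a regular non-source vertex `v` that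
emits exactly one edge `f₀`, which is not a loop: delete `v`, `f₀` and all edges into
`v`, and add an edge `[e f₀]` from `s e` to `r f₀` for every edge `e` into `v`. -/
def collapseOne (G : CKGraph) (v : G.V) (f₀ : G.E) (hf : G.s f₀ = v)
    (honly : ∀ e, G.s e = v → e = f₀) (hr : G.r f₀ ≠ v) : CKGraph where
  V := {w : G.V // w ≠ v}
  E := {e : G.E // G.r e ≠ v ∧ e ≠ f₀} ⊕ {e : G.E // G.r e = v}
  r x :=
    match x with
    | .inl e => ⟨G.r e.1, e.2.1⟩
    | .inr _ => ⟨G.r f₀, hr⟩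
  s x :=
    match x with
    | .inl e => ⟨G.s e.1, fun h => e.2.2 (honly e.1 h)⟩
    | .inr e => ⟨G.s e.1, by
        intro h
        have h2 : G.r e.1 = v := e.2
        rw [honly e.1 h] at h2
        exact hr h2⟩

/-- The graph obtained from `G` by collapsing a regular vertex `v` which does not
support a loop of length one: delete `v` and all edges into or out of `v`, and add
an edge `[e f]` from `s e` to `r f` for every pair of edges `e, f` with
`r e = v = s f`. -/
def collapse (G : CKGraph) (v : G.V) (hnl : ∀ e, G.s e = v → G.r e ≠ v) :
    CKGraph where
  V := {w : G.V // w ≠ v}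
  E := {e : G.E // G.r e ≠ v ∧ G.s e ≠ v} ⊕
    ({e : G.E // G.r e = v} × {f : G.E // G.s f = v})
  s x :=
    match x with
    | .inl e => ⟨G.s e.1, e.2.2⟩
    | .inr p => ⟨G.s p.1.1, fun h => hnl p.1.1 h p.1.2⟩
  r x :=
    match x with
    | .inl e => ⟨G.r e.1, e.2.1⟩
    | .inr p => ⟨G.r p.2.1, fun h => hnl p.2.1 p.2.2 h⟩

/-- The graph obtained from `G` by adding countably infinitely many new edges,
each with source `u` and range `w`. -/
def addEdges (G : CKGraph) (u w : G.V) : CKGraph where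
  V := G.V
  E := G.E ⊕ ℕ
  r x := match x with | .inl e => G.r e | .inr _ => w
  s x := match x with | .inl e => G.s e | .inr _ => u

/-- The graph with exactly one vertex and no edges. -/
def singletonGraph : CKGraph where
  V := PUnit
  E := Empty
  r e := e.elim
  s e := e.elim

/-- The Cuntz splice of `G` at `v`: add two new vertices `u₁, u₂` and six new edges:
`v → u₁`, `u₁ → v`, a loop at `u₁`, `u₁ → u₂`, `u₂ → u₁`, and a loop at `u₂`. -/
def cuntzSplice (G : CKGraph) (v : G.V) : CKGraph where
  V := G.V ⊕ Fin 2
  E := G.E ⊕ Fin 6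
  s x :=
    match x with
    | .inl e => Sum.inl (G.s e)
    | .inr i => ![Sum.inl v, Sum.inr 0, Sum.inr 0, Sum.inr 0, Sum.inr 1, Sum.inr 1] i
  r x :=
    match x with
    | .inl e => Sum.inl (G.r e)
    | .inr i => ![Sum.inr 0, Sum.inl v, Sum.inr 0, Sum.inr 1, Sum.inr 0, Sum.inr 1] i

/-- The adjacency matrix (as an integer matrix) of a graph whose vertices are
enumerated by `Fin n`. -/
noncomputable def adjMatrix (G : CKGraph) {n : ℕ} (ρ : G.V ≃ Fin n) :
    Matrix (Fin n) (Fin n) ℤ :=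
  Matrix.of fun i j => (Nat.card {e : G.E // G.s e = ρ.symm i ∧ G.r e = ρ.symm j} : ℤ)

end CKGraph

/-- The graph of an `ℕ∞`-valued square matrix: it has exactly `A x y` edges from
`x` to `y`. -/
def graphOfMatrix {n : ℕ} (A : Matrix (Fin n) (Fin n) ℕ∞) : CKGraph where
  V := Fin n
  E := Σ x : Fin n, Σ y : Fin n, {k : ℕ // (k : ℕ∞) < A x y}
  s e := e.1
  r e := e.2.1

/-- Move-equivalence of (possibly differently sized) square matrices over `ℕ∞`. -/
def MatMoveEquiv {m n : ℕ} (A : Matrix (Fin m) (Fin m) ℕ∞)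
    (B : Matrix (Fin n) (Fin n) ℕ∞) : Prop :=
  CKGraph.MoveEquiv (graphOfMatrix A) (graphOfMatrix B)

/-- A square matrix is irreducible if any index connects to any other index through
a chain of non-zero entries. -/
def MatIrreducible {n : ℕ} {α : Type*} [Zero α] (A : Matrix (Fin n) (Fin n) α) :
    Prop :=
  ∀ i j : Fin n, ∃ (l : ℕ) (c : ℕ → Fin n), 1 ≤ l ∧ c 0 = i ∧ c l = j ∧
    ∀ t < l, A (c t) (c (t + 1)) ≠ 0

/-- `Jmat n m` is the `n × n` matrix whose top-left `m × m` block is the identity,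
whose other entries in the first `m` rows are `0`, and whose last `n - m` rows have
every entry equal to `∞`. -/
def Jmat (n m : ℕ) : Matrix (Fin n) (Fin n) ℕ∞ :=
  Matrix.of fun i j => if i.1 < m then (if i = j then 1 else 0) else ⊤

namespace CKGraph

/-- Build an isomorphism of graphs from bijective maps intertwining ranges and sources. -/
noncomputable def Iso.ofBijective {G H : CKGraph} (φ : G.V → H.V) (ψ : G.E → H.E)
    (hφ : Function.Bijective φ) (hψ : Function.Bijective ψ)
    (hr : ∀ e, H.r (ψ e) = φ (G.r e)) (hs : ∀ e, H.s (ψ e) = φ (G.s e)) : Iso G H where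
  vEquiv := Equiv.ofBijective φ hφ
  eEquiv := Equiv.ofBijective ψ hψ
  map_r := hr
  map_s := hs

/-- Add to `G` a new vertex `none` receiving one edge from `i` and emitting the edges `F`,
with ranges given by `ρ`. -/
def delay (G : CKGraph) (i : G.V) (F : Type) (ρ : F → G.V) : CKGraph where
  V := Option G.V
  E := Option (G.E ⊕ F)
  r x :=
    match x with
    | none => none
    | some (.inl e) => some (G.r e)
    | some (.inr f) => some (ρ f)
  s x :=
    match x with
    | none => some i
    | some (.inl e) => some (G.s e)
    | some (.inr _) => none

/-- Add to `G` the edges `F` with source `i` and ranges given by `ρ`. -/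
def shortcut (G : CKGraph) (i : G.V) (F : Type) (ρ : F → G.V) : CKGraph where
  V := G.V
  E := G.E ⊕ F
  r := Sum.elim G.r ρ
  s := Sum.elim G.s fun _ => i

/-- Delete the edge `e₀` from `G`. -/
def deleteEdge (G : CKGraph) (e₀ : G.E) : CKGraph where
  V := G.V
  E := {e : G.E // e ≠ e₀}
  r e := G.r e.1
  s e := G.s e.1

theorem delay_moveEquiv_shortcut_of_unique (G : CKGraph) (hG : Finite G.V) (i : G.V) (F : Type)
    [Unique F] (ρ : F → G.V) : MoveEquiv (G.delay i F ρ) (G.shortcut i F ρ) := by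
  have hV : Finite (G.delay i F ρ).V := inferInstanceAs (Finite (Option G.V))
  refine MoveEquiv.moveR hV none (some (.inr default)) rfl (Option.some_ne_none _) ?_ (some i) ?_
    ⟨Iso.ofBijective (fun v => ⟨some v, Option.some_ne_none v⟩)
      (fun x => match x with
        | .inl e => .inl ⟨some (.inl e), Option.some_ne_none _,
            fun h => Sum.inl_ne_inr (Option.some_injective _ h)⟩
        | .inr _ => .inr ⟨none, rfl⟩) ?_ ?_ ?_ ?_⟩
  · rintro (_ | e | f) h
    · cases h
    · cases h
    · rw [Unique.eq_default f]
  · rintro (_ | e | f) h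
    · rfl
    · cases h
    · cases h
  · constructor
    · intro a b h
      exact Option.some_injective _ (congrArg Subtype.val h)
    · rintro ⟨_ | v, hv⟩
      · exact absurd rfl hv
      · exact ⟨v, rfl⟩
  · constructor
    · rintro (e | f) (e' | f') h
      · have h := congrArg Subtype.val (Sum.inl_injective h)
        exact congrArg Sum.inl (Sum.inl_injective (Option.some_injective _ h))
      · cases h
      · cases h
      · rw [Subsingleton.elim f f']
    · rintro (⟨_ | e | f, h1, h2⟩ | ⟨_ | e | f, h⟩)
      · exact absurd rfl h1
      · exact ⟨.inl e, rfl⟩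
      · exact absurd (by rw [Unique.eq_default f]) h2
      · exact ⟨.inr default, rfl⟩
      · cases h
      · cases h
  · rintro (e | f)
    · rfl
    · rw [Unique.eq_default f]
      rfl
  · rintro (e | f) <;> rfl

/-- Out-splitting the added vertex separates one of the edges it emits from the others. -/
theorem delay_option_moveEquiv (G : CKGraph) (hG : Finite G.V) (i : G.V) (F : Type) [Finite F]
    [Nonempty F] (ρ : Option F → G.V) :
    MoveEquiv (G.delay i (Option F) ρ)
      ((G.delay i F fun f => ρ (some f)).delay (some i) Unit fun _ => some (ρ none)) := by
  have hV : Finite (G.delay i (Option F) ρ).V := inferInstanceAs (Finite (Option G.V))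
  have hfin : Finite {e : (G.delay i (Option F) ρ).E // (G.delay i (Option F) ρ).s e = none} := by
    refine Finite.of_surjective
      (fun f : Option F => (⟨some (.inr f), rfl⟩ :
        {e : (G.delay i (Option F) ρ).E // (G.delay i (Option F) ρ).s e = none})) ?_
    rintro ⟨_ | e | f, h⟩
    · cases h
    · cases h
    · exact ⟨f, rfl⟩
  let φ : Option (Option G.V) → {w : Option G.V // w ≠ none} ⊕ Fin 2
    | none => .inr 0
    | some none => .inr 1
    | some (some v) => .inl ⟨some v, Option.some_ne_none v⟩
  let R : Option (G.E ⊕ Option F) → Option G.V := (G.delay i (Option F) ρ).r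
  let ψ : Option (Option (G.E ⊕ F) ⊕ Unit) → {e // R e ≠ none} ⊕ {e // R e = none} × Fin 2
    | none => .inr (⟨none, rfl⟩, 0)
    | some (.inl none) => .inr (⟨none, rfl⟩, 1)
    | some (.inl (some (.inl e))) => .inl ⟨some (.inl e), Option.some_ne_none _⟩
    | some (.inl (some (.inr f))) => .inl ⟨some (.inr (some f)), Option.some_ne_none _⟩
    | some (.inr _) => .inl ⟨some (.inr none), Option.some_ne_none _⟩
  have hφ : Function.Bijective φ := by
    constructor
    · rintro (_ | _ | v) (_ | _ | w) h <;> simp_all [φ]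
    · rintro (⟨_ | v, hv⟩ | k)
      · exact absurd rfl hv
      · exact ⟨some (some v), rfl⟩
      · fin_cases k
        · exact ⟨none, rfl⟩
        · exact ⟨some none, rfl⟩
  have hψ : Function.Bijective ψ := by
    constructor
    · rintro (_ | (_ | e | f) | _) (_ | (_ | e' | f') | _) h <;>
        replace h := congrArg (Sum.elim (fun e => (e.1, none)) fun p => (p.1.1, some p.2)) h <;>
        simp_all [ψ]
    · rintro (⟨_ | e | _ | f, h⟩ | ⟨⟨_ | e | f, h⟩, k⟩)
      · exact absurd rfl h
      · exact ⟨some (.inl (some (.inl e))), rfl⟩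
      · exact ⟨some (.inr ()), rfl⟩
      · exact ⟨some (.inl (some (.inr f))), rfl⟩
      · fin_cases k
        · exact ⟨none, rfl⟩
        · exact ⟨some (.inl none), rfl⟩
      · cases h
      · cases h
  refine MoveEquiv.moveO hV none (fun h => h (some (.inr none)) rfl) 2
    (fun e => match e with
      | ⟨some (.inr none), _⟩ => 0
      | _ => 1) ?_ ?_ ⟨Iso.ofBijective φ ψ hφ hψ ?_ ?_⟩
  · intro k
    obtain ⟨f⟩ := ‹Nonempty F›
    fin_cases k
    · exact ⟨⟨some (.inr none), rfl⟩, rfl⟩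
    · exact ⟨⟨some (.inr (some f)), rfl⟩, rfl⟩
  · intro _ _ h
    exact absurd (Set.toFinite _) h
  · rintro (_ | (_ | e | f) | _) <;> rfl
  · rintro (_ | (_ | e | f) | _) <;> simp [outSplit, delay, φ, ψ]

/-- A vertex receiving a single edge and emitting finitely many edges can be collapsed. -/
theorem delay_moveEquiv_shortcut (F : Type) [Finite F] :
    Nonempty F → ∀ (G : CKGraph), Finite G.V → ∀ (i : G.V) (ρ : F → G.V),
      MoveEquiv (G.delay i F ρ) (G.shortcut i F ρ) := by
  induction F using Finite.induction_empty_option with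
  | @of_equiv F' F σ ih =>
    intro hF G hG i ρ
    refine .trans (.of_iso (H := G.delay i F' (ρ ∘ σ)) (inferInstanceAs (Finite (Option G.V)))
      ⟨⟨Equiv.refl _, Equiv.optionCongr (Equiv.sumCongr (Equiv.refl _) σ.symm), ?_, ?_⟩⟩)
      (.trans (ih (σ.nonempty_congr.2 hF) G hG i (ρ ∘ σ)) (.of_iso hG
        ⟨⟨Equiv.refl _, Equiv.sumCongr (Equiv.refl _) σ, ?_, ?_⟩⟩))
    · rintro (_ | e | f)
      · rfl
      · rfl
      · exact congrArg (fun f => some (ρ f)) (σ.apply_symm_apply f)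
    · rintro (_ | e | f) <;> rfl
    · rintro (e | f) <;> rfl
    · rintro (e | f) <;> rfl
  | h_empty => exact fun h => h.elim fun x => x.elim
  | @h_option F _ ih =>
    intro _ G hG i ρ
    rcases isEmpty_or_nonempty F with hF | hF
    · exact delay_moveEquiv_shortcut_of_unique G hG i (Option F) ρ
    · have hV : Finite (Option G.V) := inferInstance
      refine .trans (delay_option_moveEquiv G hG i F ρ)
        (.trans (delay_moveEquiv_shortcut_of_unique _ hV _ _ _) (.trans (.of_iso hV
          (H := (G.shortcut i Unit fun _ => ρ none).delay i F fun f => ρ (some f)) ?_)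
        (.trans (ih hF (G.shortcut i Unit fun _ => ρ none) hG i fun f => ρ (some f))
          (.of_iso hG ?_))))
      · refine ⟨Iso.ofBijective id
          (fun x => match x with
            | .inl none => none
            | .inl (some (.inl e)) => some (.inl (.inl e))
            | .inl (some (.inr f)) => some (.inr f)
            | .inr _ => some (.inl (.inr ()))) Function.bijective_id ⟨?_, ?_⟩ ?_ ?_⟩
        · rintro ((_ | e | f) | _) ((_ | e' | f') | _) h <;> cases h <;> rfl
        · rintro (_ | (e | _) | f)
          exacts [⟨.inl none, rfl⟩, ⟨.inl (some (.inl e)), rfl⟩, ⟨.inr (), rfl⟩,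
            ⟨.inl (some (.inr f)), rfl⟩]
        · rintro ((_ | e | f) | _) <;> rfl
        · rintro ((_ | e | f) | _) <;> rfl
      · refine ⟨Iso.ofBijective id
          (fun x => match x with
            | .inl (.inl e) => .inl e
            | .inl (.inr _) => .inr none
            | .inr f => .inr (some f)) Function.bijective_id ⟨?_, ?_⟩ ?_ ?_⟩
        · rintro ((e | _) | f) ((e' | _) | f') h <;> cases h <;> rfl
        · rintro (e | _ | f)
          exacts [⟨.inl (.inl e), rfl⟩, ⟨.inl (.inr ()), rfl⟩, ⟨.inr f, rfl⟩]
        · rintro ((e | _) | f) <;> rfl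
        · rintro ((e | _) | f) <;> rfl

/-- In-splitting the range of `e₀` separates `e₀` from the other edges with the same range. -/
theorem moveEquiv_delay_deleteEdge (G : CKGraph) (hG : Finite G.V) (e₀ : G.E)
    (hne : G.s e₀ ≠ G.r e₀) (hreg : G.Regular (G.r e₀)) (e₁ : G.E) (he : e₁ ≠ e₀)
    (hr : G.r e₁ = G.r e₀) :
    MoveEquiv G ((G.deleteEdge e₀).delay (G.s e₀) {f : G.E // G.s f = G.r e₀}
      fun f => G.r f.1) := by
  classical
  let φ : Option G.V → {w : G.V // w ≠ G.r e₀} ⊕ Fin 2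
    | none => .inr 0
    | some v => if h : v = G.r e₀ then .inr 1 else .inl ⟨v, h⟩
  let ψ : Option ({e : G.E // e ≠ e₀} ⊕ {f : G.E // G.s f = G.r e₀}) →
      {e : G.E // G.s e ≠ G.r e₀} ⊕ {e : G.E // G.s e = G.r e₀} × Fin 2
    | none => .inl ⟨e₀, hne⟩
    | some (.inl e) => if h : G.s e.1 = G.r e₀ then .inr (⟨e.1, h⟩, 1) else .inl ⟨e.1, h⟩
    | some (.inr f) => .inr (f, 0)
  have hφ : Function.Bijective φ := by
    constructor
    · rintro (_ | v) (_ | w) h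
      · rfl
      · by_cases hw : w = G.r e₀ <;> simp [φ, hw] at h
      · by_cases hv : v = G.r e₀ <;> simp [φ, hv] at h
      · by_cases hv : v = G.r e₀ <;> by_cases hw : w = G.r e₀ <;> simp_all [φ]
    · rintro (⟨v, hv⟩ | k)
      · exact ⟨some v, dif_neg hv⟩
      · fin_cases k
        · exact ⟨none, rfl⟩
        · exact ⟨some (G.r e₀), dif_pos rfl⟩
  have hψ : Function.Bijective ψ := by
    constructor
    · rintro (_ | ⟨e, he⟩ | f) (_ | ⟨e', he'⟩ | f') h
      · rfl
      · by_cases h1 : G.s e' = G.r e₀ <;> simp [ψ, h1] at h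
        exact absurd h.symm he'
      · simp [ψ] at h
      · by_cases h1 : G.s e = G.r e₀ <;> simp [ψ, h1] at h
        exact absurd h he
      · by_cases h1 : G.s e = G.r e₀ <;> by_cases h2 : G.s e' = G.r e₀ <;> simp_all [ψ]
      · by_cases h1 : G.s e = G.r e₀ <;> simp [ψ, h1] at h
      · simp [ψ] at h
      · by_cases h1 : G.s e' = G.r e₀ <;> simp [ψ, h1] at h
      · simp_all [ψ]
    · rintro (⟨e, h⟩ | ⟨⟨e, h⟩, k⟩)
      · by_cases h0 : e = e₀
        · subst h0
          exact ⟨none, rfl⟩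
        · exact ⟨some (.inl ⟨e, h0⟩), dif_neg h⟩
      · fin_cases k
        · exact ⟨some (.inr ⟨e, h⟩), rfl⟩
        · exact ⟨some (.inl ⟨e, fun h0 => hne (h0 ▸ h)⟩), dif_pos h⟩
  refine MoveEquiv.moveI hG (G.r e₀) hreg (fun h => h e₀ rfl) 2
    (fun e => if e.1 = e₀ then 0 else 1) ?_ ⟨Iso.ofBijective φ ψ hφ hψ ?_ ?_⟩
  · intro k
    fin_cases k
    · exact ⟨⟨e₀, rfl⟩, if_pos rfl⟩
    · exact ⟨⟨e₁, hr⟩, if_neg he⟩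
  · rintro (_ | ⟨e, he⟩ | ⟨f, hf⟩)
    · simp [inSplit, delay, φ, ψ]
    · by_cases h1 : G.s e = G.r e₀ <;> by_cases h2 : G.r e = G.r e₀ <;>
        simp [inSplit, delay, deleteEdge, φ, ψ, h1, h2, he]
    · have hf0 : f ≠ e₀ := fun h0 => hne (h0 ▸ hf)
      by_cases h2 : G.r f = G.r e₀ <;> simp [inSplit, delay, φ, ψ, h2, hf0]
  · rintro (_ | ⟨e, he⟩ | ⟨f, hf⟩)
    · simp [inSplit, delay, φ, ψ, hne]
    · by_cases h1 : G.s e = G.r e₀ <;> simp [inSplit, delay, deleteEdge, φ, ψ, h1]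
    · simp [inSplit, delay, φ, ψ]

/-- An edge `e₀` which is not a loop, whose range is regular and receives another edge, can be
replaced by the paths `e₀ f` with `f` emitted by the range of `e₀`. -/
theorem moveEquiv_shortcut_deleteEdge (G : CKGraph) (hG : Finite G.V) (e₀ : G.E)
    (hne : G.s e₀ ≠ G.r e₀) (hreg : G.Regular (G.r e₀)) (e₁ : G.E) (he : e₁ ≠ e₀)
    (hr : G.r e₁ = G.r e₀) :
    MoveEquiv G ((G.deleteEdge e₀).shortcut (G.s e₀) {f : G.E // G.s f = G.r e₀}
      fun f => G.r f.1) := by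
  have : Finite {f : G.E // G.s f = G.r e₀} := hreg.2.to_subtype
  exact .trans (moveEquiv_delay_deleteEdge G hG e₀ hne hreg e₁ he hr)
    (delay_moveEquiv_shortcut _ (nonempty_subtype.2 hreg.1) (G.deleteEdge e₀) hG _ _)

end CKGraph

theorem encard_setOf_lt (a : ℕ∞) : {k : ℕ | (k : ℕ∞) < a}.encard = a := by
  induction a using ENat.recTopCoe with
  | top => simp
  | coe a =>
    have : {k : ℕ | (k : ℕ∞) < a} = (Finset.range a : Set ℕ) := by
      ext k
      simp
    rw [this, Set.encard_coe_eq_coe_finsetCard, Finset.card_range]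

theorem graphOfMatrix_encard {n : ℕ} (A : Matrix (Fin n) (Fin n) ℕ∞) (x y : Fin n) :
    {e | (graphOfMatrix A).s e = x ∧ (graphOfMatrix A).r e = y}.encard = A x y := by
  let ι : {k : ℕ // (k : ℕ∞) < A x y} → (graphOfMatrix A).E := fun k => ⟨x, y, k⟩
  have hι : Function.Injective ι := by
    intro k k' h
    simpa using show (⟨x, y, k⟩ : Σ x : Fin n, Σ y : Fin n, {k : ℕ // (k : ℕ∞) < A x y}) =
      ⟨x, y, k'⟩ from h
  have h : {e | (graphOfMatrix A).s e = x ∧ (graphOfMatrix A).r e = y} = ι '' Set.univ := by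
    rw [Set.image_univ]
    ext ⟨x', y', k⟩
    constructor
    · rintro ⟨h1, h2⟩
      obtain rfl : x' = x := h1
      obtain rfl : y' = y := h2
      exact ⟨k, rfl⟩
    · rintro ⟨k', h⟩
      rw [← h]
      exact ⟨rfl, rfl⟩
  rw [h, hι.encard_image, Set.encard_univ]
  exact encard_setOf_lt (A x y)

/-- The number of edges from `x` to `y` after replacing the edge `e₀` by the paths `e₀ f`. -/
theorem encard_replace_edge {V E : Type} [DecidableEq V] (r s : E → V) (e₀ : E) (x y : V) :
    {e : {e : E // e ≠ e₀} ⊕ {f : E // s f = r e₀} |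
      Sum.elim (fun e => s e.1) (fun _ => s e₀) e = x ∧
        Sum.elim (fun e => r e.1) (fun f => r f.1) e = y}.encard =
      ({e | s e = x ∧ r e = y} \ {e₀}).encard +
        if x = s e₀ then {f | s f = r e₀ ∧ r f = y}.encard else 0 := by
  have hsplit : {e : {e : E // e ≠ e₀} ⊕ {f : E // s f = r e₀} |
      Sum.elim (fun e => s e.1) (fun _ => s e₀) e = x ∧
        Sum.elim (fun e => r e.1) (fun f => r f.1) e = y} =
      Sum.inl '' {e | s e.1 = x ∧ r e.1 = y} ∪ Sum.inr '' {f | s e₀ = x ∧ r f.1 = y} := by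
    ext (e | f) <;> simp
  have hold : {e : {e : E // e ≠ e₀} | s e.1 = x ∧ r e.1 = y}.encard =
      ({e | s e = x ∧ r e = y} \ {e₀}).encard := by
    rw [← Subtype.val_injective.encard_image]
    congr 1
    ext e
    simp
  rw [hsplit, Set.encard_union_eq Set.disjoint_image_inl_image_inr,
    Sum.inl_injective.encard_image, Sum.inr_injective.encard_image, hold]
  congr 1
  split_ifs with hx
  · rw [← Subtype.val_injective.encard_image]
    congr 1
    ext e
    simp [hx, and_comm]
  · simp [Ne.symm hx]

/-- A graph with countably many edges and vertex set `Fin n` is determined by its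
adjacency matrix. -/
theorem nonempty_iso_graphOfMatrix {n : ℕ} (E : Type) [Countable E] (r s : E → Fin n)
    (B : Matrix (Fin n) (Fin n) ℕ∞) (h : ∀ x y, {e | s e = x ∧ r e = y}.encard = B x y) :
    Nonempty (CKGraph.Iso ⟨Fin n, E, r, s⟩ (graphOfMatrix B)) := by
  have key : ∀ x y, Nonempty ({e // s e = x ∧ r e = y} ≃ {k : ℕ // (k : ℕ∞) < B x y}) := by
    intro x y
    rw [← Cardinal.eq]
    refine Cardinal.toENat_injOn (Cardinal.mk_le_aleph0) (Cardinal.mk_le_aleph0) ?_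
    exact (h x y).trans (encard_setOf_lt (B x y)).symm
  have τ := fun x y => Classical.choice (key x y)
  refine ⟨CKGraph.Iso.ofBijective id (fun e => ⟨s e, r e, τ _ _ ⟨e, rfl, rfl⟩⟩)
    Function.bijective_id ⟨?_, ?_⟩ (fun _ => rfl) (fun _ => rfl)⟩
  · have hinj : ∀ x y x' y' (p : {e // s e = x ∧ r e = y}) (p' : {e // s e = x' ∧ r e = y'}),
        (⟨x, y, τ x y p⟩ : (graphOfMatrix B).E) = ⟨x', y', τ x' y' p'⟩ → p.1 = p'.1 := by
      intro x y x' y' p p' h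
      obtain rfl : x = x' := congrArg (graphOfMatrix B).s h
      obtain rfl : y = y' := congrArg (graphOfMatrix B).r h
      have h : τ x y p = τ x y p' := by simpa using h
      rw [(τ x y).injective h]
    intro e e' h
    exact hinj _ _ _ _ _ _ h
  · rintro ⟨x, y, k⟩
    obtain ⟨⟨e, rfl, rfl⟩, rfl⟩ := (τ x y).surjective k
    exact ⟨e, rfl⟩

/-- Row addition: adding row `j` to row `i`, subtracting `1` at the
`(i,j)` entry, preserves move-equivalence, provided the diagonal has no zeros,
`A i j ≠ 0` and row `j` contains no `∞`. -/
theorem stmt7 {n : ℕ} (A : Matrix (Fin n) (Fin n) ℕ∞) (hdiag : ∀ i, A i i ≠ 0)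
    (i j : Fin n) (hij : i ≠ j) (hAij : A i j ≠ 0) (hrow : ∀ l, A j l ≠ ⊤) :
    MatMoveEquiv A (Matrix.of fun k l =>
      if k = i then (if l = j then A i j + A j j - 1 else A i l + A j l)
      else A k l) := by
  have : Countable (graphOfMatrix A).E :=
    inferInstanceAs (Countable (Σ x : Fin n, Σ y : Fin n, {k : ℕ // (k : ℕ∞) < A x y}))
  set G := graphOfMatrix A
  have hG : Finite G.V := inferInstanceAs (Finite (Fin n))
  let e₀ : G.E := ⟨i, j, 0, by simpa using pos_iff_ne_zero.2 hAij⟩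
  let e₁ : G.E := ⟨j, j, 0, by simpa using pos_iff_ne_zero.2 (hdiag j)⟩
  have he : e₁ ≠ e₀ := fun h => hij (congrArg G.s h).symm
  have hfin : {e | G.s e = j}.Finite := by
    have h : {e | G.s e = j} = ⋃ l : Fin n, {e | G.s e = j ∧ G.r e = l} := by
      ext e
      exact ⟨fun h => Set.mem_iUnion.2 ⟨G.r e, h, rfl⟩,
        fun h => (Set.mem_iUnion.1 h).elim fun _ h => h.1⟩
    rw [h]
    refine Set.finite_iUnion fun l => Set.encard_ne_top_iff.1 ?_
    rw [graphOfMatrix_encard]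
    exact hrow l
  refine .trans (CKGraph.moveEquiv_shortcut_deleteEdge G hG e₀ hij ⟨⟨e₁, rfl⟩, hfin⟩ e₁ he rfl)
    (.of_iso hG (nonempty_iso_graphOfMatrix ({e : G.E // e ≠ e₀} ⊕ {f : G.E // G.s f = j}) _ _ _
      fun x y => ?_))
  let r : G.E → Fin n := G.r
  let s : G.E → Fin n := G.s
  have hcard : ∀ x y, {e | s e = x ∧ r e = y}.encard = A x y := graphOfMatrix_encard A
  have hs : s e₀ = i := rfl
  have hr : r e₀ = j := rfl
  refine (encard_replace_edge r s e₀ x y).trans ?_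
  rw [hs, hr, hcard, Matrix.of_apply]
  by_cases hx : x = i
  · subst hx
    rw [if_pos rfl, if_pos rfl]
    by_cases hy : y = j
    · subst hy
      have h := Set.encard_sdiff_singleton_add_one
        (show e₀ ∈ {e | s e = x ∧ r e = y} from ⟨rfl, rfl⟩)
      rw [hcard] at h
      rw [if_pos rfl, ← h, add_right_comm]
      exact (AddLECancellable.add_tsub_cancel_right
        (ENat.addLECancellable_of_ne_top ENat.one_ne_top)).symm
    · rw [if_neg hy, Set.sdiff_singleton_eq_self fun h => hy h.2.symm, hcard]
  · rw [if_neg hx, if_neg hx, add_zero, Set.sdiff_singleton_eq_self fun h => hx h.1.symm,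
      hcard]
end

section
/- (Column addition.) Let A be a square matrix over ℕ ∪ {∞} with no zeros on the diagonal, and let i ≠ j be indices such that A(j,i) ≠ 0. Let A' be the matrix obtained from A by replacing each entry A(l,i) with A(l,i) + A(l,j) for l ≠ j, and replacing A(j,i) with A(j,i) + A(j,j) − 1, all other entries unchanged. Then A ∼_M A'. -/
namespace CKGraph

/-- The identity isomorphism. -/
def Iso.refl (G : CKGraph) : Iso G G := ⟨.refl _, .refl _, fun _ => rfl, fun _ => rfl⟩

/-- An isomorphism of graphs from bijective maps on vertices and edges. -/
theorem nonempty_iso_of_bijective {G H : CKGraph} (φ : G.V → H.V) (ψ : G.E → H.E)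
    (hφ : φ.Bijective) (hψ : ψ.Bijective) (hr : ∀ e, H.r (ψ e) = φ (G.r e))
    (hs : ∀ e, H.s (ψ e) = φ (G.s e)) : Nonempty (Iso G H) :=
  ⟨⟨.ofBijective φ hφ, .ofBijective ψ hψ, hr, hs⟩⟩

open Classical in
/-- The graph obtained from `G` by letting every edge from `S` to `v` end in `w` instead. -/
noncomputable def reroute (G : CKGraph) (v w : G.V) (S : Set G.V) : CKGraph where
  V := G.V
  E := G.E
  r e := if G.r e = v ∧ G.s e ∈ S then w else G.r e
  s := G.s

open Classical in
theorem reroute_of_forall_not {G : CKGraph} {v w : G.V} {S : Set G.V}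
    (h : ∀ e, G.r e = v → G.s e ∉ S) : G.reroute v w S = G := by
  have : (fun e => if G.r e = v ∧ G.s e ∈ S then w else G.r e) = G.r := by
    funext e
    exact if_neg fun h' => h e h'.1 h'.2
  cases G
  simp_all [reroute]

theorem reroute_r_of_mem {G : CKGraph} {v : G.V} (w : G.V) {S : Set G.V} {e : G.E}
    (h : G.r e = v) (hS : G.s e ∈ S) : (G.reroute v w S).r e = w :=
  if_pos ⟨h, hS⟩

theorem reroute_r_of_ne {G : CKGraph} {v : G.V} (w : G.V) (S : Set G.V) {e : G.E}
    (h : G.r e ≠ v) : (G.reroute v w S).r e = G.r e :=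
  if_neg fun h' => h h'.1

theorem reroute_r_of_notMem {G : CKGraph} (v w : G.V) {S : Set G.V} {e : G.E}
    (h : G.s e ∉ S) : (G.reroute v w S).r e = G.r e :=
  if_neg fun h' => h h'.2

theorem inSplit_r_inl_of_eq {G : CKGraph} {v : G.V} {n : ℕ} {P : {e : G.E // G.r e = v} → Fin n}
    (e : {e : G.E // G.s e ≠ v}) (h : G.r e.1 = v) :
    (G.inSplit v n P).r (Sum.inl e) = Sum.inr (P ⟨e.1, h⟩) :=
  dif_pos h

theorem inSplit_r_inl_of_ne {G : CKGraph} {v : G.V} {n : ℕ} {P : {e : G.E // G.r e = v} → Fin n}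
    (e : {e : G.E // G.s e ≠ v}) (h : G.r e.1 ≠ v) :
    (G.inSplit v n P).r (Sum.inl e) = Sum.inl ⟨G.r e.1, h⟩ :=
  dif_neg h

theorem inSplit_r_inr_of_ne {G : CKGraph} {v : G.V} {n : ℕ} {P : {e : G.E // G.r e = v} → Fin n}
    (e : {e : G.E // G.s e = v}) (k : Fin n) (h : G.r e.1 ≠ v) :
    (G.inSplit v n P).r (Sum.inr (e, k)) = Sum.inl ⟨G.r e.1, h⟩ :=
  dif_neg h

theorem outSplit_s_inl_of_eq {G : CKGraph} {v : G.V} {n : ℕ} {P : {e : G.E // G.s e = v} → Fin n}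
    (e : {e : G.E // G.r e ≠ v}) (h : G.s e.1 = v) :
    (G.outSplit v n P).s (Sum.inl e) = Sum.inr (P ⟨e.1, h⟩) :=
  dif_pos h

theorem outSplit_s_inl_of_ne {G : CKGraph} {v : G.V} {n : ℕ} {P : {e : G.E // G.s e = v} → Fin n}
    (e : {e : G.E // G.r e ≠ v}) (h : G.s e.1 ≠ v) :
    (G.outSplit v n P).s (Sum.inl e) = Sum.inl ⟨G.s e.1, h⟩ :=
  dif_neg h

theorem outSplit_s_inr_of_eq {G : CKGraph} {v : G.V} {n : ℕ} {P : {e : G.E // G.s e = v} → Fin n}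
    (e : {e : G.E // G.r e = v}) (k : Fin n) (h : G.s e.1 = v) :
    (G.outSplit v n P).s (Sum.inr (e, k)) = Sum.inr (P ⟨e.1, h⟩) :=
  dif_pos h

theorem outSplit_s_inr_of_ne {G : CKGraph} {v : G.V} {n : ℕ} {P : {e : G.E // G.s e = v} → Fin n}
    (e : {e : G.E // G.r e = v}) (k : Fin n) (h : G.s e.1 ≠ v) :
    (G.outSplit v n P).s (Sum.inr (e, k)) = Sum.inl ⟨G.s e.1, h⟩ :=
  dif_neg h

theorem reroute_insert {G : CKGraph} {v w : G.V} (hw : w ≠ v) (a : G.V) (S : Set G.V) :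
    (G.reroute v w S).reroute v w {a} = G.reroute v w (insert a S) := by
  have h : ((G.reroute v w S).reroute v w {a}).r = (G.reroute v w (insert a S)).r := by
    funext e
    by_cases h1 : G.r e = v
    · by_cases h2 : G.s e ∈ S
      · have h3 := reroute_r_of_mem w h1 h2
        rw [reroute_r_of_ne (G := G.reroute v w S) w {a} (h3.trans_ne hw), h3,
          reroute_r_of_mem w h1 (.inr h2)]
      · have h3 := reroute_r_of_notMem v w h2
        by_cases h4 : G.s e = a
        · rw [reroute_r_of_mem (G := G.reroute v w S) (S := {a}) w (h3.trans h1) h4,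
            reroute_r_of_mem w h1 (.inl h4)]
        · rw [reroute_r_of_notMem (G := G.reroute v w S) v w (S := {a}) h4, h3,
            reroute_r_of_notMem v w (S := insert a S) fun h => h.elim h4 h2]
    · have h3 := reroute_r_of_ne w S h1
      rw [reroute_r_of_ne (G := G.reroute v w S) w {a} (h3.trans_ne h1), h3,
        reroute_r_of_ne w _ h1]
  exact congrArg (fun r => CKGraph.mk G.V G.E r G.s) h

/-- If `v` is regular, emits the single edge `f`, and `f` is not a loop, then all edges into `v`
coming from one vertex can be prolonged along `f`. -/
theorem moveEquiv_reroute_singleton {G : CKGraph} (hG : Finite G.V) (v : G.V) (f : G.E)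
    (hf : G.s f = v) (hrf : G.r f ≠ v) (honly : ∀ e, G.s e = v → e = f) (a : G.V) :
    MoveEquiv G (G.reroute v (G.r f) {a}) := by
  classical
  have hreg : G.Regular v :=
    ⟨⟨f, hf⟩, (Set.finite_singleton f).subset fun e he => honly e he⟩
  by_cases h1 : ∃ e, G.r e = v ∧ G.s e = a
  swap
  · rw [reroute_of_forall_not]
    · exact .of_iso hG ⟨.refl G⟩
    · exact fun e he hs => h1 ⟨e, he, hs⟩
  obtain ⟨e₁, hr₁, hs₁⟩ := h1
  have hav : a ≠ v := by
    rintro rfl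
    exact hrf (honly e₁ hs₁ ▸ hr₁)
  by_cases h2 : ∃ e, G.r e = v ∧ G.s e ≠ a
  · obtain ⟨e₂, hr₂, hs₂⟩ := h2
    let P : {e : G.E // G.r e = v} → Fin 2 := fun e => if G.s e.1 = a then 0 else 1
    have hP : Function.Surjective P := by
      intro x
      fin_cases x
      · exact ⟨⟨e₁, hr₁⟩, by simp [P, hs₁]⟩
      · exact ⟨⟨e₂, hr₂⟩, by simp [P, hs₂]⟩
    have hfin : Finite (G.inSplit v 2 P).V :=
      inferInstanceAs (Finite ({w : G.V // w ≠ v} ⊕ Fin 2))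
    refine .trans (.moveI hG v hreg (fun h => h e₁ hr₁) 2 P hP ⟨.refl _⟩) ?_
    let u : (G.inSplit v 2 P).V := Sum.inr 0
    let f' : (G.inSplit v 2 P).E := Sum.inr (⟨f, hf⟩, 0)
    have hrf' : (G.inSplit v 2 P).r f' = Sum.inl ⟨G.r f, hrf⟩ := inSplit_r_inr_of_ne _ _ hrf
    have hrfu : (G.inSplit v 2 P).r f' ≠ u := by
      rw [hrf']
      exact Sum.inl_ne_inr
    have honly' : ∀ e, (G.inSplit v 2 P).s e = u → e = f' := by
      rintro (e | ⟨⟨e, he⟩, k⟩) h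
      · exact absurd h Sum.inl_ne_inr
      · obtain rfl := honly e he
        obtain rfl : k = 0 := Sum.inr_injective h
        rfl
    have hP0 : ∀ e, P e = 0 ↔ G.s e.1 = a := by
      intro e
      by_cases h : G.s e.1 = a <;> simp [P, h]
    have hru : ∀ e, (G.inSplit v 2 P).r e = u → ∃ e' : {e : G.E // G.s e ≠ v},
        e = Sum.inl e' ∧ G.r e'.1 = v ∧ G.s e'.1 = a := by
      rintro (e | ⟨⟨e, he⟩, k⟩) h
      · by_cases hre : G.r e.1 = v
        · rw [inSplit_r_inl_of_eq _ hre] at h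
          exact ⟨e, rfl, hre, (hP0 _).1 (Sum.inr_injective h)⟩
        · rw [inSplit_r_inl_of_ne _ hre] at h
          exact absurd h Sum.inl_ne_inr
      · have hre : G.r e ≠ v := by rwa [honly e he]
        rw [inSplit_r_inr_of_ne _ _ hre] at h
        exact absurd h Sum.inl_ne_inr
    have hin' : ∀ e, (G.inSplit v 2 P).r e = u →
        (G.inSplit v 2 P).s e = Sum.inl ⟨a, hav⟩ := by
      intro e h
      obtain ⟨e', rfl, -, he'⟩ := hru e h
      exact congrArg Sum.inl (Subtype.ext he')
    refine .trans (.moveR hfin u f' rfl hrfu honly' (Sum.inl ⟨a, hav⟩) hin' ⟨.refl _⟩) ?_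
    have hfin' : Finite ((G.inSplit v 2 P).reduce u f' rfl hrfu honly' _ hin').V :=
      inferInstanceAs (Finite {w : (G.inSplit v 2 P).V // w ≠ u})
    refine .of_iso hfin' ?_
    let vm : (G.inSplit v 2 P).V → G.V := Sum.elim Subtype.val fun _ => v
    let em : (G.inSplit v 2 P).E → G.E := Sum.elim Subtype.val fun p => p.1.1
    refine nonempty_iso_of_bijective (H := G.reroute v (G.r f) {a}) (fun x => vm x.1)
      (Sum.elim (fun e => em e.1) (fun e => em e.1)) ?_ ?_ ?_ ?_
    · constructor
      · rintro ⟨⟨x, hx⟩ | k, hk⟩ ⟨⟨y, hy⟩ | l, hl⟩ h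
        · obtain rfl : x = y := h
          rfl
        · exact absurd h hx
        · exact absurd h.symm hy
        · have hk' : k ≠ 0 := fun h => hk (congrArg Sum.inr h)
          have hl' : l ≠ 0 := fun h => hl (congrArg Sum.inr h)
          obtain rfl : k = l := by omega
          rfl
      · intro x
        by_cases hx : x = v
        · exact ⟨⟨Sum.inr 1, fun h => one_ne_zero (Sum.inr_injective h)⟩, hx.symm⟩
        · exact ⟨⟨Sum.inl ⟨x, hx⟩, Sum.inl_ne_inr⟩, rfl⟩
    · have hem : ∀ x y, x ≠ f' → y ≠ f' → em x = em y → x = y := by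
        rintro (⟨x, hx⟩ | ⟨⟨x, hx⟩, k⟩) (⟨y, hy⟩ | ⟨⟨y, hy⟩, l⟩) hxf hyf h
        · obtain rfl : x = y := h
          rfl
        · obtain rfl : x = y := h
          exact absurd hy hx
        · obtain rfl : x = y := h
          exact absurd hx hy
        · obtain rfl : x = y := h
          have h0 : ∀ k : Fin 2, Sum.inr (⟨x, hx⟩, k) ≠ f' → k = 1 := by
            intro k hk
            by_contra h
            obtain rfl : k = 0 := by omega
            exact hk (congrArg (fun z => Sum.inr (z, 0)) (Subtype.ext (honly x hx)))
          rw [h0 k hxf, h0 l hyf]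
      have hne : ∀ x, (G.inSplit v 2 P).r x = u → x ≠ f' := by
        rintro x hx rfl
        exact hrfu hx
      constructor
      · rintro (⟨x, hx⟩ | ⟨x, hx⟩) (⟨y, hy⟩ | ⟨y, hy⟩) h
        · obtain rfl := hem x y hx.2 hy.2 h
          rfl
        · obtain rfl := hem x y hx.2 (hne y hy) h
          exact absurd hy hx.1
        · obtain rfl := hem x y (hne x hx) hy.2 h
          exact absurd hx hy.1
        · obtain rfl := hem x y (hne x hx) (hne y hy) h
          rfl
      · intro e
        obtain ⟨x, hxf, rfl⟩ : ∃ x, x ≠ f' ∧ em x = e := by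
          by_cases he : G.s e = v
          · exact ⟨Sum.inr (⟨e, he⟩, 1), fun h =>
              one_ne_zero (congrArg Prod.snd (Sum.inr_injective h)), rfl⟩
          · exact ⟨Sum.inl ⟨e, he⟩, Sum.inl_ne_inr, rfl⟩
        by_cases hx : (G.inSplit v 2 P).r x = u
        · exact ⟨Sum.inr ⟨x, hx⟩, rfl⟩
        · exact ⟨Sum.inl ⟨x, hx, hxf⟩, rfl⟩
    · have hr0 : ∀ x, (G.inSplit v 2 P).r x ≠ u →
          (G.reroute v (G.r f) {a}).r (em x) = vm ((G.inSplit v 2 P).r x) := by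
        rintro (x | ⟨⟨x, hx⟩, k⟩) h
        · by_cases hxv : G.r x.1 = v
          · rw [inSplit_r_inl_of_eq _ hxv] at h ⊢
            have hxa : G.s x.1 ∉ ({a} : Set G.V) :=
              fun h' => h (congrArg Sum.inr ((hP0 ⟨x.1, hxv⟩).2 h'))
            exact (reroute_r_of_notMem _ _ hxa).trans hxv
          · rw [inSplit_r_inl_of_ne _ hxv]
            exact reroute_r_of_ne _ _ hxv
        · have hrx : G.r x ≠ v := by rwa [honly x hx]
          rw [inSplit_r_inr_of_ne _ _ hrx]
          exact reroute_r_of_ne _ _ hrx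
      have hr1 : ∀ x, (G.inSplit v 2 P).r x = u →
          (G.reroute v (G.r f) {a}).r (em x) = vm ((G.inSplit v 2 P).r f') := by
        intro x h
        obtain ⟨x, rfl, hxv, hxa⟩ := hru x h
        rw [hrf']
        exact reroute_r_of_mem _ hxv hxa
      rintro (⟨x, hx⟩ | ⟨x, hx⟩)
      · exact hr0 x hx.1
      · exact hr1 x hx
    · have hs0 : ∀ x, G.s (em x) = vm ((G.inSplit v 2 P).s x) := by
        rintro (⟨x, hx⟩ | ⟨⟨x, hx⟩, k⟩)
        · rfl
        · exact hx
      rintro (x | x)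
      · exact hs0 x.1
      · exact hs0 x.1
  · push Not at h2
    refine .trans (.moveR hG v f hf hrf honly a h2 ⟨.refl _⟩) ?_
    have hsrc : (G.reroute v (G.r f) {a}).IsSource v := by
      intro e
      by_cases hre : G.r e = v
      · simp [reroute, hre, h2 e hre, hrf]
      · simp [reroute, hre]
    refine .symm (.moveS (G := G.reroute v (G.r f) {a}) hG v hreg hsrc ?_)
    refine nonempty_iso_of_bijective (H := (G.reroute v (G.r f) {a}).removeSource v hsrc) id
      (Sum.elim (fun e => ⟨e.1, fun h => e.2.2 (honly _ h)⟩)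
        fun e => ⟨e.1, fun h => hav ((h2 _ e.2).symm.trans h)⟩) Function.bijective_id ?_ ?_ ?_
    · constructor
      · rintro (⟨x, hx⟩ | ⟨x, hx⟩) (⟨y, hy⟩ | ⟨y, hy⟩) h <;>
          obtain rfl : x = y := congrArg Subtype.val h
        · rfl
        · exact absurd hy hx.1
        · exact absurd hx hy.1
        · rfl
      · rintro ⟨e, he⟩
        by_cases hre : G.r e = v
        · exact ⟨Sum.inr ⟨e, hre⟩, rfl⟩
        · exact ⟨Sum.inl ⟨e, hre, fun h => he (h ▸ hf)⟩, rfl⟩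
    · rintro (⟨x, hx⟩ | ⟨x, hx⟩) <;> refine Subtype.ext ?_
      · exact if_neg fun h => hx.1 h.1
      · exact if_pos ⟨hx, h2 x hx⟩
    · rintro (x | x) <;> rfl

/-- If `v` is regular, emits the single edge `f`, and `f` is not a loop, then all edges into `v`
coming from a set of vertices can be prolonged along `f`. -/
theorem moveEquiv_reroute {G : CKGraph} (hG : Finite G.V) (v : G.V) (f : G.E)
    (hf : G.s f = v) (hrf : G.r f ≠ v) (honly : ∀ e, G.s e = v → e = f) (S : Set G.V) :
    MoveEquiv G (G.reroute v (G.r f) S) := by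
  induction S, S.toFinite using Set.Finite.induction_on with
  | empty =>
    rw [reroute_of_forall_not fun _ _ => Set.notMem_empty _]
    exact .of_iso hG ⟨.refl G⟩
  | @insert a S _ _ ih =>
    rw [← reroute_insert hrf]
    have hrf' : (G.reroute v (G.r f) S).r f = G.r f := by
      simp [reroute, hrf]
    refine ih.trans ?_
    have := moveEquiv_reroute_singleton (G := G.reroute v (G.r f) S) hG v f hf
      (hrf'.symm ▸ hrf) honly a
    rwa [hrf'] at this

/-- The graph obtained from `G` by deleting the edge `f` and adding, for every edge `e` with range
`s f`, a new edge from `s e` to `r f`. -/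
def columnAdd (G : CKGraph) (f : G.E) : CKGraph where
  V := G.V
  E := {e : G.E // e ≠ f} ⊕ {e : G.E // G.r e = G.s f}
  r := Sum.elim (fun e => G.r e.1) fun _ => G.r f
  s := Sum.elim (fun e => G.s e.1) fun e => G.s e.1

/-- Out-splitting `s f` with `{f}` as one class and then bypassing the new vertex emitting only `f`
produces the graph `G.columnAdd f`. -/
theorem moveEquiv_columnAdd {G : CKGraph} (hG : Finite G.V) (f g : G.E)
    (hrf : G.r f ≠ G.s f) (hg : G.s g = G.s f) (hgf : g ≠ f) :
    MoveEquiv G (G.columnAdd f) := by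
  classical
  generalize hj : G.s f = j at *
  let P : {e : G.E // G.s e = j} → Fin 2 := fun e => if e.1 = f then 1 else 0
  have hP : Function.Surjective P := by
    intro x
    fin_cases x
    · exact ⟨⟨g, hg⟩, by simp [P, hgf]⟩
    · exact ⟨⟨f, hj⟩, by simp [P]⟩
  have hP1 : {x | P x = 1}.Finite := by
    refine (Set.finite_singleton (⟨f, hj⟩ : {e : G.E // G.s e = j})).subset ?_
    rintro ⟨e, he⟩ h
    by_contra h'
    simp_all [P]
  refine .trans (.moveO hG j (fun h => h f hj) 2 P hP ?_ ⟨.refl _⟩) ?_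
  · intro k l hk hl
    have key : ∀ k : Fin 2, {x | P x = k}.Infinite → k = 0 := by
      intro k hk
      by_contra h
      obtain rfl : k = 1 := by omega
      exact hk hP1
    rw [key k hk, key l hl]
  have hfin : Finite (G.outSplit j 2 P).V :=
    inferInstanceAs (Finite ({w : G.V // w ≠ j} ⊕ Fin 2))
  let O := G.outSplit j 2 P
  let v : O.V := Sum.inr 1
  let f' : O.E := Sum.inl ⟨f, hrf⟩
  have hPf : ∀ e, P e = 1 ↔ e.1 = f := by
    intro e
    by_cases h : e.1 = f <;> simp [P, h]
  have hf' : O.s f' = v :=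
    (outSplit_s_inl_of_eq _ hj).trans (congrArg Sum.inr ((hPf _).2 rfl))
  have hrf' : O.r f' ≠ v := Sum.inl_ne_inr
  have honly : ∀ e, O.s e = v → e = f' := by
    rintro (⟨e, he⟩ | ⟨⟨e, he⟩, k⟩) h
    · by_cases hej : G.s e = j
      · have h' := (outSplit_s_inl_of_eq ⟨e, he⟩ hej).symm.trans h
        obtain rfl : e = f := (hPf _).1 (Sum.inr_injective h')
        rfl
      · exact absurd ((outSplit_s_inl_of_ne ⟨e, he⟩ hej).symm.trans h) Sum.inl_ne_inr
    · by_cases hej : G.s e = j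
      · have h' := (outSplit_s_inr_of_eq ⟨e, he⟩ k hej).symm.trans h
        obtain rfl : e = f := (hPf _).1 (Sum.inr_injective h')
        exact absurd he hrf
      · exact absurd ((outSplit_s_inr_of_ne ⟨e, he⟩ k hej).symm.trans h) Sum.inl_ne_inr
  refine .trans (moveEquiv_reroute hfin v f' hf' hrf' honly Set.univ) ?_
  have hsrc : (O.reroute v (O.r f') Set.univ).IsSource v := by
    intro e
    by_cases hre : O.r e = v
    · simp [reroute, hre, hrf']
    · simp [reroute, hre]
  refine .moveS (G := O.reroute v (O.r f') Set.univ) hfin v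
    ⟨⟨f', hf'⟩, (Set.finite_singleton f').subset fun e he => honly e he⟩ hsrc ?_
  let vm : G.V → O.V := fun x => if h : x = j then Sum.inr 0 else Sum.inl ⟨x, h⟩
  have hvmj : vm j = Sum.inr 0 := dif_pos rfl
  have hvmn : ∀ x (h : x ≠ j), vm x = Sum.inl ⟨x, h⟩ := fun x h => dif_neg h
  have hvm : ∀ x, vm x ≠ v := by
    intro x
    by_cases hx : x = j
    · rw [hx, hvmj]
      exact fun h => zero_ne_one (Sum.inr_injective h)
    · rw [hvmn x hx]
      exact Sum.inl_ne_inr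
  let em : (G.columnAdd f).E → O.E := Sum.elim
    (fun e => if h : G.r e.1 = j then Sum.inr (⟨e.1, h⟩, 0) else Sum.inl ⟨e.1, h⟩)
    (fun e => Sum.inr (⟨e.1, e.2.trans hj⟩, 1))
  have heml : ∀ e (h : G.r e.1 = j), em (Sum.inl e) = Sum.inr (⟨e.1, h⟩, 0) :=
    fun e h => dif_pos h
  have hemn : ∀ e (h : G.r e.1 ≠ j), em (Sum.inl e) = Sum.inl ⟨e.1, h⟩ :=
    fun e h => dif_neg h
  have hP0 : ∀ e, e.1 ≠ f → P e = 0 := fun e he => if_neg he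
  have hsl : ∀ e, e ≠ f → ∀ h, O.s (Sum.inl ⟨e, h⟩) = vm (G.s e) := by
    intro e he h
    by_cases hs : G.s e = j
    · rw [hs, hvmj, ← hP0 ⟨e, hs⟩ he]
      exact outSplit_s_inl_of_eq _ hs
    · rw [hvmn _ hs]
      exact outSplit_s_inl_of_ne _ hs
  have hsr : ∀ e k, O.s (Sum.inr (e, k)) = vm (G.s e.1) := by
    rintro ⟨e, he⟩ k
    have hef : e ≠ f := by
      rintro rfl
      exact hrf he
    by_cases hs : G.s e = j
    · rw [hs, hvmj, ← hP0 ⟨e, hs⟩ hef]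
      exact outSplit_s_inr_of_eq _ _ hs
    · rw [hvmn _ hs]
      exact outSplit_s_inr_of_ne _ _ hs
  have hems : ∀ e, O.s (em e) = vm ((G.columnAdd f).s e) := by
    rintro (e | e)
    · by_cases hr : G.r e.1 = j
      · rw [heml e hr]
        exact hsr _ _
      · rw [hemn e hr]
        exact hsl _ e.2 _
    · exact hsr _ _
  refine nonempty_iso_of_bijective
    (H := (O.reroute v (O.r f') Set.univ).removeSource v hsrc) (fun x => ⟨vm x, hvm x⟩)
    (fun e => ⟨em e, (hems e).trans_ne (hvm _)⟩) ⟨?_, ?_⟩ ⟨?_, ?_⟩ ?_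
    (fun e => Subtype.ext (hems e))
  · intro x y h
    replace h : vm x = vm y := congrArg Subtype.val h
    by_cases hx : x = j <;> by_cases hy : y = j
    · rw [hx, hy]
    · rw [hx, hvmj, hvmn y hy] at h
      exact absurd h Sum.inr_ne_inl
    · rw [hy, hvmj, hvmn x hx] at h
      exact absurd h Sum.inl_ne_inr
    · rw [hvmn x hx, hvmn y hy] at h
      exact congrArg Subtype.val (Sum.inl_injective h)
  · rintro ⟨⟨x, hx⟩ | k, h⟩
    · exact ⟨x, Subtype.ext (hvmn x hx)⟩
    · have hk : k ≠ 1 := fun h' => h (congrArg Sum.inr h')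
      obtain rfl : k = 0 := by omega
      exact ⟨j, Subtype.ext hvmj⟩
  · let pm : O.E → G.E × ℕ := Sum.elim (fun e => (e.1, 0)) fun p => (p.1.1, p.2.1)
    have hpl : ∀ e, pm (em (Sum.inl e)) = (e.1, 0) := by
      intro e
      by_cases hr : G.r e.1 = j
      · rw [heml e hr]; rfl
      · rw [hemn e hr]; rfl
    have hpr : ∀ e, pm (em (Sum.inr e)) = (e.1, 1) := fun e => rfl
    rintro (x | x) (y | y) h <;> replace h := congrArg (fun e => pm e.1) h <;>
      simp only [hpl, hpr, Prod.mk.injEq] at h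
    · exact congrArg Sum.inl (Subtype.ext h.1)
    · exact absurd h.2 zero_ne_one
    · exact absurd h.2 one_ne_zero
    · exact congrArg Sum.inr (Subtype.ext h.1)
  · rintro ⟨⟨e, he⟩ | ⟨⟨e, he⟩, k⟩, h⟩
    · have hef : e ≠ f := by
        rintro rfl
        exact h hf'
      exact ⟨Sum.inl ⟨e, hef⟩, Subtype.ext (hemn ⟨e, hef⟩ he)⟩
    · by_cases hk : k = 1
      · subst hk
        exact ⟨Sum.inr ⟨e, he.trans hj.symm⟩, rfl⟩
      · obtain rfl : k = 0 := by omega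
        have hef : e ≠ f := by
          rintro rfl
          exact hrf he
        exact ⟨Sum.inl ⟨e, hef⟩, Subtype.ext (heml ⟨e, hef⟩ he)⟩
  · rintro (e | e) <;> refine Subtype.ext ?_
    · change (O.reroute v (O.r f') Set.univ).r (em (Sum.inl e)) = vm (G.r e.1)
      by_cases hr : G.r e.1 = j
      · rw [heml e hr, hr, hvmj]
        exact reroute_r_of_ne _ _ fun h => zero_ne_one (Sum.inr_injective h)
      · rw [hemn e hr, hvmn _ hr]
        exact reroute_r_of_ne _ _ Sum.inl_ne_inr
    · exact (reroute_r_of_mem (G := O) _ rfl (Set.mem_univ _)).trans (hvmn _ hrf).symm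

end CKGraph

theorem ENat.card_coe_lt (c : ℕ∞) : ENat.card {k : ℕ // (k : ℕ∞) < c} = c := by
  induction c with
  | top =>
    have : Infinite {k : ℕ // (k : ℕ∞) < ⊤} :=
      (Equiv.subtypeUnivEquiv ENat.natCast_lt_top).infinite_iff.2 inferInstance
    exact ENat.card_eq_top_of_infinite
  | coe m =>
    simp only [Nat.cast_lt]
    rw [ENat.card_congr (Fin.equivSubtype (n := m)).symm]
    simp

theorem nonempty_equiv_of_enatCard_eq {α β : Type*} [Countable α] [Countable β]
    (h : ENat.card α = ENat.card β) : Nonempty (α ≃ β) := by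
  rcases finite_or_infinite α with hα | hα
  · have hβ : Finite β := by
      rw [← ENat.card_lt_top] at hα ⊢
      rwa [← h]
    refine Finite.card_eq.1 ?_
    rw [ENat.card_eq_coe_natCard, ENat.card_eq_coe_natCard] at h
    exact_mod_cast h
  · have hβ : Infinite β := by
      rw [← ENat.card_eq_top] at hα ⊢
      rwa [← h]
    exact nonempty_equiv_of_countable

namespace CKGraph

theorem nonempty_iso_graphOfMatrix {n : ℕ} {A : Matrix (Fin n) (Fin n) ℕ∞} (G : CKGraph)
    [Countable G.E] (φ : G.V ≃ Fin n)
    (h : ∀ k l, ENat.card {e : G.E // φ (G.s e) = k ∧ φ (G.r e) = l} = A k l) :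
    Nonempty (Iso G (graphOfMatrix A)) := by
  have h' : ∀ k l, Nonempty ({e : G.E // φ (G.s e) = k ∧ φ (G.r e) = l} ≃
      {m : ℕ // (m : ℕ∞) < A k l}) := fun k l =>
    nonempty_equiv_of_enatCard_eq ((h k l).trans (ENat.card_coe_lt _).symm)
  let ψ := fun k l => (h' k l).some
  refine ⟨φ, .ofBijective (fun e => ⟨φ (G.s e), φ (G.r e), ψ _ _ ⟨e, rfl, rfl⟩⟩) ⟨?_, ?_⟩,
    fun _ => rfl, fun _ => rfl⟩
  · have key : ∀ k l e (h : φ (G.s e) = k ∧ φ (G.r e) = l),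
        (⟨φ (G.s e), φ (G.r e), ψ _ _ ⟨e, rfl, rfl⟩⟩ : (graphOfMatrix A).E) =
          ⟨k, l, ψ k l ⟨e, h⟩⟩ := by
      rintro _ _ e ⟨rfl, rfl⟩
      rfl
    intro e e' hee
    have hs : φ (G.s e) = φ (G.s e') := congrArg (graphOfMatrix A).s hee
    have hr : φ (G.r e) = φ (G.r e') := congrArg (graphOfMatrix A).r hee
    have h := (key _ _ e ⟨hs, hr⟩).symm.trans hee
    simp only [Sigma.mk.injEq, heq_eq_eq, true_and, EmbeddingLike.apply_eq_iff_eq,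
      Subtype.mk.injEq] at h
    exact h
  · rintro ⟨k, l, m⟩
    obtain ⟨⟨e, rfl, rfl⟩, rfl⟩ := (ψ k l).surjective m
    exact ⟨e, rfl⟩

theorem enatCard_graphOfMatrix {n : ℕ} (A : Matrix (Fin n) (Fin n) ℕ∞) (k l : Fin n) :
    ENat.card {e : (graphOfMatrix A).E // (graphOfMatrix A).s e = k ∧
      (graphOfMatrix A).r e = l} = A k l := by
  rw [← ENat.card_coe_lt (A k l)]
  refine (ENat.card_congr (.ofBijective (fun m => ⟨⟨k, l, m⟩, rfl, rfl⟩) ⟨?_, ?_⟩)).symm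
  · intro m m' h
    have h' : (⟨k, l, m⟩ : (graphOfMatrix A).E) = ⟨k, l, m'⟩ := congrArg Subtype.val h
    simpa only [Sigma.mk.injEq, heq_eq_eq, true_and] using h'
  · rintro ⟨⟨k', l', m⟩, hk, hl⟩
    cases hk
    cases hl
    exact ⟨m, rfl⟩

theorem enatCard_columnAdd_left (G : CKGraph) (f : G.E) (k l : G.V) :
    ENat.card {e : {e : G.E // e ≠ f} // G.s e.1 = k ∧ G.r e.1 = l} =
      ({e | G.s e = k ∧ G.r e = l} \ {f} : Set G.E).encard :=
  ENat.card_congr ⟨fun e => ⟨e.1.1, e.2, e.1.2⟩, fun e => ⟨⟨e.1, e.2.2⟩, e.2.1⟩,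
    fun _ => rfl, fun _ => rfl⟩

theorem enatCard_columnAdd (G : CKGraph) (f : G.E) (k l : G.V) :
    ENat.card {e : (G.columnAdd f).E // (G.columnAdd f).s e = k ∧ (G.columnAdd f).r e = l} =
      ({e | G.s e = k ∧ G.r e = l} \ {f} : Set G.E).encard +
        ENat.card {e : {e : G.E // G.r e = G.s f} // G.s e.1 = k ∧ G.r f = l} := by
  rw [← enatCard_columnAdd_left, ← ENat.card_sum]
  exact ENat.card_congr Equiv.subtypeSum

theorem enatCard_columnAdd_of_ne {G : CKGraph} {f : G.E} (k : G.V) {l : G.V} (hl : l ≠ G.r f) :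
    ENat.card {e : (G.columnAdd f).E // (G.columnAdd f).s e = k ∧ (G.columnAdd f).r e = l} =
      {e | G.s e = k ∧ G.r e = l}.encard := by
  have : IsEmpty {e : {e : G.E // G.r e = G.s f} // G.s e.1 = k ∧ G.r f = l} :=
    ⟨fun e => hl e.2.2.symm⟩
  rw [enatCard_columnAdd, (ENat.card_eq_zero_iff_empty _).2 this, add_zero,
    Set.sdiff_singleton_eq_self fun h => hl h.2.symm]

theorem enatCard_columnAdd_range (G : CKGraph) (f : G.E) (k : G.V) :
    ENat.card {e : (G.columnAdd f).E //
        (G.columnAdd f).s e = k ∧ (G.columnAdd f).r e = G.r f} =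
      ({e | G.s e = k ∧ G.r e = G.r f} \ {f} : Set G.E).encard +
        {e | G.s e = k ∧ G.r e = G.s f}.encard := by
  rw [enatCard_columnAdd]
  exact congrArg _ (ENat.card_congr ⟨fun e => ⟨e.1.1, e.2.1, e.1.2⟩,
    fun e => ⟨⟨e.1, e.2.2⟩, e.2.1, rfl⟩, fun _ => rfl, fun _ => rfl⟩)

theorem enatCard_columnAdd_range_of_ne {G : CKGraph} {f : G.E} {k : G.V} (hk : k ≠ G.s f) :
    ENat.card {e : (G.columnAdd f).E //
        (G.columnAdd f).s e = k ∧ (G.columnAdd f).r e = G.r f} =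
      {e | G.s e = k ∧ G.r e = G.r f}.encard + {e | G.s e = k ∧ G.r e = G.s f}.encard := by
  rw [enatCard_columnAdd_range, Set.sdiff_singleton_eq_self fun h => hk h.1.symm]

theorem enatCard_columnAdd_source_range (G : CKGraph) (f : G.E) :
    ENat.card {e : (G.columnAdd f).E //
        (G.columnAdd f).s e = G.s f ∧ (G.columnAdd f).r e = G.r f} =
      {e | G.s e = G.s f ∧ G.r e = G.r f}.encard +
        {e | G.s e = G.s f ∧ G.r e = G.s f}.encard - 1 := by
  have hf : f ∈ {e | G.s e = G.s f ∧ G.r e = G.r f} := ⟨rfl, rfl⟩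
  rw [enatCard_columnAdd_range, Set.encard_sdiff_singleton_of_mem hf,
    (ENat.addLECancellable_of_ne_top ENat.one_ne_top).tsub_add_eq_add_tsub
      (Set.one_le_encard_iff_nonempty.2 ⟨f, hf⟩)]

end CKGraph

/-- Column addition: adding column `j` to column `i`, subtracting `1`
at the `(j,i)` entry, preserves move-equivalence, provided the diagonal has no zeros
and `A j i ≠ 0`. -/
theorem stmt8 {n : ℕ} (A : Matrix (Fin n) (Fin n) ℕ∞) (hdiag : ∀ i, A i i ≠ 0)
    (i j : Fin n) (hij : i ≠ j) (hAji : A j i ≠ 0) :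
    MatMoveEquiv A (Matrix.of fun k l =>
      if l = i then (if k = j then A j i + A j j - 1 else A k i + A k j)
      else A k l) := by
  have h0 : ∀ {c : ℕ∞}, c ≠ 0 → ((0 : ℕ) : ℕ∞) < c := fun h => by
    simpa using pos_iff_ne_zero.2 h
  let G := graphOfMatrix A
  let f : G.E := ⟨j, i, 0, h0 hAji⟩
  let g : G.E := ⟨j, j, 0, h0 (hdiag j)⟩
  have hfin : Finite G.V := inferInstanceAs (Finite (Fin n))
  have hgf : g ≠ f := fun h => hij.symm (congrArg G.r h)
  refine (CKGraph.moveEquiv_columnAdd hfin f g hij rfl hgf).trans (.of_iso hfin ?_)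
  have : Countable G.E :=
    inferInstanceAs (Countable (Σ x : Fin n, Σ y : Fin n, {k : ℕ // (k : ℕ∞) < A x y}))
  have : Countable (G.columnAdd f).E :=
    inferInstanceAs (Countable ({e : G.E // e ≠ f} ⊕ {e : G.E // G.r e = j}))
  refine CKGraph.nonempty_iso_graphOfMatrix (G.columnAdd f) (.refl _) fun k l => ?_
  have hA : ∀ k l, {e | G.s e = k ∧ G.r e = l}.encard = A k l :=
    CKGraph.enatCard_graphOfMatrix A
  rw [Matrix.of_apply]
  by_cases hl : l = i
  · subst hl
    rw [if_pos rfl]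
    by_cases hk : k = j
    · subst hk
      rw [if_pos rfl, ← hA k l, ← hA k k]
      exact CKGraph.enatCard_columnAdd_source_range G f
    · rw [if_neg hk, ← hA k l, ← hA k j]
      exact CKGraph.enatCard_columnAdd_range_of_ne (f := f) hk
  · rw [if_neg hl, ← hA k l]
    exact CKGraph.enatCard_columnAdd_of_ne (f := f) k hl
end

section
/- Let n ≥ m ≥ 0 and let B be an n×n matrix with non-negative integer entries whose last n−m rows are zero, such that A = J_{nm} + B is irreducible and the top-left m×m corner of A is irreducible. If B' is obtained from B by adding one column of B to a different column, or by adding a non-zero row of B to a different non-zero row, then J_{nm} + B ∼_M J_{nm} + B'. -/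
namespace CKGraph

/-- The opposite graph, with all edges reversed. -/
abbrev op (G : CKGraph) : CKGraph := ⟨G.V, G.E, G.s, G.r⟩

theorem inSplit_eq (G : CKGraph) (v : G.V) (n : ℕ) (P : {e : G.E // G.r e = v} → Fin n) :
    G.inSplit v n P = (G.op.outSplit v n P).op := by
  unfold inSplit outSplit op
  congr 1
  all_goals
    funext x
    rcases x with x | x <;> rfl

/-- The number of edges from `x` to `y`. -/
noncomputable def adj (G : CKGraph) (x y : G.V) : ℕ∞ :=
  ENat.card {e : G.E // G.s e = x ∧ G.r e = y}

theorem adj_op (G : CKGraph) (x y : G.V) : G.op.adj x y = G.adj y x :=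
  ENat.card_congr (Equiv.subtypeEquivRight fun _ => and_comm)

theorem nonempty_equiv_of_enatCard_eq {α β : Type} [Countable α] [Countable β]
    (h : ENat.card α = ENat.card β) : Nonempty (α ≃ β) := by
  by_cases hα : Infinite α
  · have hβ : Infinite β := by rwa [← ENat.card_eq_top, ← h, ENat.card_eq_top]
    exact nonempty_equiv_of_countable
  · have hβ : ¬ Infinite β := by rwa [← ENat.card_eq_top, ← h, ENat.card_eq_top]
    rw [not_infinite_iff_finite] at hα hβ
    rw [ENat.card_eq_coe_natCard, ENat.card_eq_coe_natCard, Nat.cast_inj] at h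
    exact Finite.card_eq.1 h

theorem nonempty_iso_of_adj {G H : CKGraph} [Countable G.E] [Countable H.E]
    (φ : G.V ≃ H.V) (h : ∀ x y, G.adj x y = H.adj (φ x) (φ y)) : Nonempty (Iso H G) := by
  have key : ∀ p : H.V × H.V, Nonempty ({e : H.E // (H.s e, H.r e) = p} ≃
      {e : G.E // (φ (G.s e), φ (G.r e)) = p}) := by
    rintro ⟨x, y⟩
    apply nonempty_equiv_of_enatCard_eq
    have := h (φ.symm x) (φ.symm y)
    simp only [Equiv.apply_symm_apply, adj, Equiv.eq_symm_apply] at this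
    simp only [Prod.mk.injEq]
    exact this.symm
  let ψ := fun p => (key p).some
  let Ψ : H.E ≃ G.E := (Equiv.sigmaFiberEquiv _).symm.trans
    ((Equiv.sigmaCongrRight ψ).trans (Equiv.sigmaFiberEquiv _))
  have hΨ : ∀ e, (φ (G.s (Ψ e)), φ (G.r (Ψ e))) = (H.s e, H.r e) :=
    fun e => (ψ (H.s e, H.r e) ⟨e, rfl⟩).2
  refine ⟨⟨φ.symm, Ψ, fun e => ?_, fun e => ?_⟩⟩
  · rw [Equiv.eq_symm_apply]; exact congrArg Prod.snd (hΨ e)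
  · rw [Equiv.eq_symm_apply]; exact congrArg Prod.fst (hΨ e)

section outSplit

variable (G : CKGraph) (v : G.V) (n : ℕ) (P : {e : G.E // G.s e = v} → Fin n)

/-- The edge of `G` from which an edge of the out-split originates. -/
def outSplitOrigin (e : (G.outSplit v n P).E) : G.E :=
  Sum.elim (fun e => e.1) (fun p => p.1.1) e

theorem outSplit_s_eq_inl (e : (G.outSplit v n P).E) (x : {w : G.V // w ≠ v}) :
    (G.outSplit v n P).s e = Sum.inl x ↔ G.s (outSplitOrigin G v n P e) = x := by
  obtain ⟨x, hx⟩ := x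
  rcases e with e | e
  · by_cases h : G.s e.1 = v
    · simp only [outSplit, outSplitOrigin, h, dif_pos, Sum.elim_inl, reduceCtorEq, false_iff]
      exact fun h' => hx h'.symm
    · simp [outSplit, outSplitOrigin, h]
  · by_cases h : G.s e.1.1 = v
    · simp only [outSplit, outSplitOrigin, h, dif_pos, Sum.elim_inr, reduceCtorEq, false_iff]
      exact fun h' => hx h'.symm
    · simp [outSplit, outSplitOrigin, h]

theorem outSplit_s_eq_inr (e : (G.outSplit v n P).E) (p : Fin n) :
    (G.outSplit v n P).s e = Sum.inr p ↔ ∃ h, P ⟨outSplitOrigin G v n P e, h⟩ = p := by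
  rcases e with e | e
  · by_cases h : G.s e.1 = v <;> simp [outSplit, outSplitOrigin, h]
  · by_cases h : G.s e.1.1 = v <;> simp [outSplit, outSplitOrigin, h]

theorem enatCard_outSplit (Q : G.E → Prop) (y : {w : G.V // w ≠ v} ⊕ Fin n) :
    ENat.card {e // Q (outSplitOrigin G v n P e) ∧ (G.outSplit v n P).r e = y} =
      ENat.card {e : G.E // Q e ∧ G.r e = Sum.elim (fun w => w.1) (fun _ => v) y} := by
  rcases y with ⟨y, hy⟩ | q
  · refine ENat.card_congr
      { toFun := fun e => ⟨outSplitOrigin G v n P e.1, e.2.1, ?_⟩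
        invFun := fun e => ⟨Sum.inl ⟨e.1, fun h => hy (e.2.2.symm.trans h)⟩, e.2.1, ?_⟩
        left_inv := ?_
        right_inv := fun e => rfl }
    · obtain ⟨e | e, h, h'⟩ := e
      · exact congrArg Subtype.val (Sum.inl_injective h')
      · cases h'
    · exact congrArg Sum.inl (Subtype.ext e.2.2)
    · rintro ⟨e | e, h, h'⟩
      · rfl
      · cases h'
  · refine ENat.card_congr
      { toFun := fun e => ⟨outSplitOrigin G v n P e.1, e.2.1, ?_⟩
        invFun := fun e => ⟨Sum.inr (⟨e.1, e.2.2⟩, q), e.2.1, rfl⟩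
        left_inv := ?_
        right_inv := fun e => rfl }
    · obtain ⟨e | e, h, h'⟩ := e
      · cases h'
      · exact e.1.2
    · rintro ⟨e | e, h, h'⟩
      · cases h'
      · cases h'
        rfl

theorem adj_outSplit_inl (x : {w : G.V // w ≠ v}) (y : {w : G.V // w ≠ v} ⊕ Fin n) :
    (G.outSplit v n P).adj (Sum.inl x) y = G.adj x (Sum.elim (fun w => w.1) (fun _ => v) y) := by
  exact (ENat.card_congr (Equiv.subtypeEquivRight fun e =>
    and_congr_left' (outSplit_s_eq_inl G v n P e x))).trans
      (enatCard_outSplit G v n P (fun e => G.s e = x) y)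

theorem adj_outSplit_inr (p : Fin n) (y : {w : G.V // w ≠ v} ⊕ Fin n) :
    (G.outSplit v n P).adj (Sum.inr p) y =
      ENat.card {e : G.E // (∃ h, P ⟨e, h⟩ = p) ∧
        G.r e = Sum.elim (fun w => w.1) (fun _ => v) y} := by
  exact (ENat.card_congr (Equiv.subtypeEquivRight fun e =>
    and_congr_left' (outSplit_s_eq_inr G v n P e p))).trans
      (enatCard_outSplit G v n P (fun e => ∃ h, P ⟨e, h⟩ = p) y)

end outSplit

/-- The graph with `A x y` edges from `x` to `y`. -/
abbrev ofAdj {V : Type} (A : V → V → ℕ∞) : CKGraph where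
  V := V
  E := Σ x : V, Σ y : V, {k : ℕ // (k : ℕ∞) < A x y}
  s e := e.1
  r e := e.2.1

instance {V : Type} [Finite V] (A : V → V → ℕ∞) : Countable (ofAdj A).E :=
  inferInstanceAs (Countable (Σ x : V, Σ y : V, {k : ℕ // (k : ℕ∞) < A x y}))

theorem enatCard_lt (N : ℕ∞) : ENat.card {k : ℕ // (k : ℕ∞) < N} = N := by
  induction N using ENat.recTopCoe with
  | top => simpa [ENat.card_eq_top] using (Equiv.subtypeUnivEquiv fun _ => trivial).infinite_iff.2 (inferInstance : Infinite ℕ)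
  | coe a =>
    rw [ENat.card_congr (β := Fin a)
      ((Equiv.subtypeEquivRight fun k => by simp).trans Fin.equivSubtype.symm)]
    simp

theorem enatCard_ge {a b : ℕ∞} (h : a = ⊤ → b = 0) :
    ENat.card {k : ℕ // (k : ℕ∞) < a + b ∧ ¬ (k : ℕ∞) < a} = b := by
  induction a using ENat.recTopCoe with
  | top => simpa [h rfl, ENat.card_eq_zero_iff_empty] using (inferInstance : IsEmpty {k : ℕ // False})
  | coe a =>
    refine Eq.trans ?_ (enatCard_lt b)
    symm
    refine ENat.card_congr
      { toFun := fun k => ⟨a + k.1, ?_⟩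
        invFun := fun k => ⟨k.1 - a, ?_⟩
        left_inv := fun k => by simp
        right_inv := fun k => ?_ }
    · refine ⟨?_, by simp⟩
      push_cast
      exact (ENat.add_lt_add_iff_left (by simp)).2 k.2
    · obtain ⟨k, h1, h2⟩ := k
      have h2 : a ≤ k := by simpa using h2
      obtain ⟨c, rfl⟩ := Nat.exists_eq_add_of_le h2
      push_cast at h1
      simpa using (ENat.add_lt_add_iff_left (by simp)).1 h1
    · obtain ⟨k, h1, h2⟩ := k
      have h2 : a ≤ k := by simpa using h2
      simp [h2]

theorem enatCard_edges {V : Type} (A : V → V → ℕ∞) (x y : V) (Q : ℕ → Prop) :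
    ENat.card {e : (ofAdj A).E // (e.1 = x ∧ Q e.2.2.1) ∧ e.2.1 = y} =
      ENat.card {k : ℕ // (k : ℕ∞) < A x y ∧ Q k} := by
  refine ENat.card_congr
    { toFun := fun e => ⟨e.1.2.2.1, ?_, e.2.1.2⟩
      invFun := fun k => ⟨⟨x, y, k.1, k.2.1⟩, ⟨rfl, k.2.2⟩, rfl⟩
      left_inv := ?_
      right_inv := fun k => rfl }
  · obtain ⟨⟨x', y', k, hk⟩, ⟨rfl, h⟩, rfl⟩ := e
    exact hk
  · rintro ⟨⟨x', y', k, hk⟩, ⟨rfl, h⟩, rfl⟩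
    rfl

theorem enatCard_edges_lt {V : Type} (A : V → V → ℕ∞) {x y : V} {a b : ℕ∞}
    (h : A x y = a + b) :
    ENat.card {e : (ofAdj A).E // (e.1 = x ∧ (e.2.2.1 : ℕ∞) < a) ∧ e.2.1 = y} = a := by
  refine (enatCard_edges A x y (fun k => (k : ℕ∞) < a)).trans (Eq.trans ?_ (enatCard_lt a))
  refine ENat.card_congr (Equiv.subtypeEquivRight fun k => ?_)
  rw [h]
  exact ⟨fun h => h.2, fun h => ⟨h.trans_le le_self_add, h⟩⟩

theorem enatCard_edges_ge {V : Type} (A : V → V → ℕ∞) {x y : V} {a b : ℕ∞}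
    (h : A x y = a + b) (hab : a = ⊤ → b = 0) :
    ENat.card {e : (ofAdj A).E // (e.1 = x ∧ ¬ (e.2.2.1 : ℕ∞) < a) ∧ e.2.1 = y} = b := by
  rw [enatCard_edges A x y (fun k => ¬ (k : ℕ∞) < a), h, enatCard_ge hab]

theorem adj_ofAdj {V : Type} (A : V → V → ℕ∞) (x y : V) : (ofAdj A).adj x y = A x y := by
  have h := enatCard_edges A x y (fun _ => True)
  simp only [and_true] at h
  rw [enatCard_lt] at h
  exact h

theorem nonempty_iso_of_adj' {G H : CKGraph} [Countable G.E] [Countable H.E]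
    (φ : H.V ≃ G.V) (h : ∀ x y, G.adj (φ x) (φ y) = H.adj x y) : Nonempty (Iso H G) :=
  nonempty_iso_of_adj φ.symm fun x y => by simpa using h (φ.symm x) (φ.symm y)

instance (G : CKGraph) [h : Countable G.E] : Countable G.op.E := h

instance (G : CKGraph) [Countable G.E] (v : G.V) (n : ℕ) (P : {e : G.E // G.s e = v} → Fin n) :
    Countable (G.outSplit v n P).E :=
  inferInstanceAs (Countable ({e : G.E // G.r e ≠ v} ⊕ ({e : G.E // G.r e = v} × Fin n)))

/-- The matrix obtained from `D` by adding one vertex with incoming edges `a`, outgoing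
edges `b` and `c` loops. -/
def extend {V : Type} (D : V → V → ℕ∞) (a b : V → ℕ∞) (c : ℕ∞) : Option V → Option V → ℕ∞
  | some x, some y => D x y
  | some x, none => a x
  | none, some y => b y
  | none, none => c

/-- The vertices of a graph split at `v` into two vertices. -/
noncomputable def splitEquiv {V : Type} (v : V) : {w : V // w ≠ v} ⊕ Fin 2 ≃ Option V :=
  Equiv.ofBijective (Sum.elim (fun w => some w.1) ![none, some v]) <| by
    constructor
    · rintro (⟨x, hx⟩ | p) (⟨y, hy⟩ | q) h
      · simpa using h
      · fin_cases q
        · simp at h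
        · exact absurd (Option.some_injective _ h) hx
      · fin_cases p
        · simp at h
        · exact absurd (Option.some_injective _ h).symm hy
      · fin_cases p <;> fin_cases q <;> simp_all
    · rintro (_ | x)
      · exact ⟨Sum.inr 0, rfl⟩
      · by_cases h : x = v
        · exact ⟨Sum.inr 1, by simp [h]⟩
        · exact ⟨Sum.inl ⟨x, h⟩, rfl⟩

theorem adj_outSplit_eq (G : CKGraph) (v : G.V) (P : {e : G.E // G.s e = v} → Fin 2)
    (D : G.V → G.V → ℕ∞) (r : G.V → ℕ∞) (hD : ∀ x y, x ≠ v → G.adj x y = D x y)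
    (h0 : ∀ y, ENat.card {e : G.E // (∃ h, P ⟨e, h⟩ = 0) ∧ G.r e = y} = r y)
    (h1 : ∀ y, ENat.card {e : G.E // (∃ h, P ⟨e, h⟩ = 1) ∧ G.r e = y} = D v y)
    (x y : {w : G.V // w ≠ v} ⊕ Fin 2) :
    (G.outSplit v 2 P).adj x y =
      extend D (fun x => D x v) r (r v) (splitEquiv v x) (splitEquiv v y) := by
  have hy : ∀ N : Option G.V → ℕ∞, N none = N (some v) →
      N (splitEquiv v y) = N (some (Sum.elim (fun w => w.1) (fun _ => v) y)) := by
    intro N hN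
    rcases y with y | q
    · rfl
    · fin_cases q
      · exact hN
      · rfl
  rcases x with x | p
  · exact (adj_outSplit_inl G v 2 P x y).trans ((hD _ _ x.2).trans
      (hy (extend D (fun x => D x v) r (r v) (some x.1)) rfl).symm)
  · refine (adj_outSplit_inr G v 2 P p y).trans (Eq.trans ?_
      (hy (extend D (fun x => D x v) r (r v) (splitEquiv v (Sum.inr p))) ?_).symm)
    · fin_cases p
      · exact h0 _
      · exact h1 _
    · fin_cases p <;> rfl

section

variable {V : Type} [Finite V]

theorem finite_edges (v : V) (A : V → V → ℕ∞) (r : V → ℕ∞) (hr : ∀ y, r y ≠ ⊤) :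
    {e : (ofAdj A).E | e.1 = v ∧ (e.2.2.1 : ℕ∞) < r e.2.1}.Finite := by
  have hfin (y : V) : Finite {k : ℕ // (k : ℕ∞) < r y} := by
    rw [← ENat.card_lt_top, enatCard_lt]
    exact (hr y).lt_top
  rw [Set.finite_coe_iff.symm]
  refine Finite.of_injective (β := Σ y : V, {k : ℕ // (k : ℕ∞) < r y})
    (fun e => ⟨e.1.2.1, e.1.2.2.1, e.2.2⟩) ?_
  rintro ⟨⟨x, y, k, hk⟩, hx, h⟩ ⟨⟨x', y', k', hk'⟩, hx', h'⟩ heq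
  obtain rfl : x = v := hx
  obtain rfl : x' = x := hx'
  simp only [Sigma.mk.injEq] at heq
  obtain ⟨rfl, heq⟩ := heq
  simp only [heq_eq_eq, Subtype.mk.injEq] at heq
  subst heq
  rfl

theorem regular_ofAdj (v : V) (A : V → V → ℕ∞) (h : ∀ y, A v y ≠ ⊤) (h0 : ∃ y, A v y ≠ 0) :
    (ofAdj A).Regular v := by
  obtain ⟨y, hy⟩ := h0
  refine ⟨⟨⟨v, y, 0, by simpa [pos_iff_ne_zero] using hy⟩, rfl⟩, ?_⟩
  refine (finite_edges v A (A v) h).subset ?_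
  rintro ⟨x, y, k, hk⟩ rfl
  exact ⟨rfl, hk⟩

theorem moveEquiv_outSplit (A D : V → V → ℕ∞) (v : V) (r : V → ℕ∞)
    (hD : ∀ x y, x ≠ v → A x y = D x y) (hv : ∀ y, A v y = r y + D v y)
    (hr : ∀ y, r y ≠ ⊤) (hr0 : ∃ y, r y ≠ 0) (hD0 : ∃ y, D v y ≠ 0) :
    MoveEquiv (ofAdj A) (ofAdj (extend D (fun x => D x v) r (r v))) := by
  classical
  let P : {e : (ofAdj A).E // (ofAdj A).s e = v} → Fin 2 :=
    fun e => if (e.1.2.2.1 : ℕ∞) < r e.1.2.1 then 0 else 1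
  have hP0 : ∀ e, P e = 0 ↔ (e.1.2.2.1 : ℕ∞) < r e.1.2.1 := fun e => by
    by_cases h : (e.1.2.2.1 : ℕ∞) < r e.1.2.1 <;> simp [P, h]
  have hP1 : ∀ e, P e = 1 ↔ ¬ (e.1.2.2.1 : ℕ∞) < r e.1.2.1 := fun e => by
    by_cases h : (e.1.2.2.1 : ℕ∞) < r e.1.2.1 <;> simp [P, h]
  have h0 : ∀ y, ENat.card {e : (ofAdj A).E // (∃ h, P ⟨e, h⟩ = 0) ∧ e.2.1 = y} = r y := by
    intro y
    rw [← enatCard_edges_lt A (hv y)]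
    refine ENat.card_congr (Equiv.subtypeEquivRight fun e => ?_)
    simp only [hP0, exists_prop]
    obtain ⟨x', y', k, hk⟩ := e
    constructor <;>
    · rintro ⟨⟨rfl, h⟩, rfl⟩
      exact ⟨⟨rfl, h⟩, rfl⟩
  have h1 : ∀ y, ENat.card {e : (ofAdj A).E // (∃ h, P ⟨e, h⟩ = 1) ∧ e.2.1 = y} =
      D v y := by
    intro y
    rw [← enatCard_edges_ge A (hv y) fun h => absurd h (hr y)]
    refine ENat.card_congr (Equiv.subtypeEquivRight fun e => ?_)
    simp only [hP1, exists_prop]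
    obtain ⟨x', y', k, hk⟩ := e
    constructor <;>
    · rintro ⟨⟨rfl, h⟩, rfl⟩
      exact ⟨⟨rfl, h⟩, rfl⟩
  have hsurj : Function.Surjective P := by
    intro p
    fin_cases p
    · obtain ⟨y, hy⟩ := hr0
      rw [← h0, ENat.card_ne_zero_iff_nonempty] at hy
      obtain ⟨e, ⟨h, h'⟩, -⟩ := hy
      exact ⟨_, h'⟩
    · obtain ⟨y, hy⟩ := hD0
      rw [← h1, ENat.card_ne_zero_iff_nonempty] at hy
      obtain ⟨e, ⟨h, h'⟩, -⟩ := hy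
      exact ⟨_, h'⟩
  have hfin : {x | P x = 0}.Finite := by
    refine Set.Finite.of_finite_image (f := Subtype.val) ?_ Subtype.val_injective.injOn
    refine (finite_edges v A r hr).subset ?_
    rintro _ ⟨e, he, rfl⟩
    exact ⟨e.2, (hP0 e).1 he⟩
  refine MoveEquiv.moveO (inferInstanceAs (Finite V)) v ?_ 2 P hsurj ?_
    (nonempty_iso_of_adj (G := (ofAdj A).outSplit v 2 P)
      (H := ofAdj (extend D (fun x => D x v) r (r v))) (splitEquiv v) fun x y => ?_)
  · obtain ⟨e, -⟩ := hsurj 0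
    exact fun h => h e.1 e.2
  · intro i j hi hj
    fin_cases i
    · exact absurd hfin hi
    · fin_cases j
      · exact absurd hfin hj
      · rfl
  · rw [adj_ofAdj]
    exact adj_outSplit_eq (ofAdj A) v P D r (fun x y hx => by rw [adj_ofAdj, hD x y hx]) h0 h1 x y

theorem moveEquiv_inSplit (A D : V → V → ℕ∞) (v : V) (r : V → ℕ∞)
    (hD : ∀ x y, y ≠ v → A x y = D x y) (hv : ∀ x, A x v = r x + D x v)
    (hr : ∀ x, r x = ⊤ → D x v = 0) (hr0 : ∃ x, r x ≠ 0) (hD0 : ∃ x, D x v ≠ 0)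
    (hA : ∀ y, A v y ≠ ⊤) (hA0 : ∃ y, A v y ≠ 0) :
    MoveEquiv (ofAdj A) (ofAdj (extend D r (fun y => D v y) (r v))) := by
  classical
  let P : {e : (ofAdj A).E // (ofAdj A).r e = v} → Fin 2 :=
    fun e => if (e.1.2.2.1 : ℕ∞) < r e.1.1 then 0 else 1
  have hP0 : ∀ e, P e = 0 ↔ (e.1.2.2.1 : ℕ∞) < r e.1.1 := fun e => by
    by_cases h : (e.1.2.2.1 : ℕ∞) < r e.1.1 <;> simp [P, h]
  have hP1 : ∀ e, P e = 1 ↔ ¬ (e.1.2.2.1 : ℕ∞) < r e.1.1 := fun e => by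
    by_cases h : (e.1.2.2.1 : ℕ∞) < r e.1.1 <;> simp [P, h]
  have h0 : ∀ x, ENat.card {e : (ofAdj A).E // (∃ h, P ⟨e, h⟩ = 0) ∧ e.1 = x} = r x := by
    intro x
    rw [← enatCard_edges_lt A (hv x)]
    refine ENat.card_congr (Equiv.subtypeEquivRight fun e => ?_)
    simp only [hP0, exists_prop]
    obtain ⟨x', y', k, hk⟩ := e
    constructor <;>
    · rintro ⟨⟨rfl, h⟩, rfl⟩
      exact ⟨⟨rfl, h⟩, rfl⟩
  have h1 : ∀ x, ENat.card {e : (ofAdj A).E // (∃ h, P ⟨e, h⟩ = 1) ∧ e.1 = x} =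
      D x v := by
    intro x
    rw [← enatCard_edges_ge A (hv x) (hr x)]
    refine ENat.card_congr (Equiv.subtypeEquivRight fun e => ?_)
    simp only [hP1, exists_prop]
    obtain ⟨x', y', k, hk⟩ := e
    constructor <;>
    · rintro ⟨⟨rfl, h⟩, rfl⟩
      exact ⟨⟨rfl, h⟩, rfl⟩
  have hsurj : Function.Surjective P := by
    intro p
    fin_cases p
    · obtain ⟨y, hy⟩ := hr0
      rw [← h0, ENat.card_ne_zero_iff_nonempty] at hy
      obtain ⟨e, ⟨h, h'⟩, -⟩ := hy
      exact ⟨_, h'⟩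
    · obtain ⟨y, hy⟩ := hD0
      rw [← h1, ENat.card_ne_zero_iff_nonempty] at hy
      obtain ⟨e, ⟨h, h'⟩, -⟩ := hy
      exact ⟨_, h'⟩
  refine MoveEquiv.moveI (inferInstanceAs (Finite V)) v (regular_ofAdj v A hA hA0) ?_ 2 P hsurj ?_
  · obtain ⟨e, -⟩ := hsurj 0
    exact fun h => h e.1 e.2
  · rw [inSplit_eq]
    refine nonempty_iso_of_adj (G := ((ofAdj A).op.outSplit v 2 P).op) (splitEquiv v)
      fun x y => ?_
    rw [adj_op, adj_ofAdj]
    refine (adj_outSplit_eq (ofAdj A).op v P (fun x y => D y x) r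
      (fun x y hx => by rw [adj_op, adj_ofAdj, hD y x hx]) h0 h1 y x).trans ?_
    cases splitEquiv v x <;> cases splitEquiv v y <;> rfl

/-- The vertices of a graph other than an added vertex. -/
noncomputable def someEquiv (V : Type) : V ≃ {w : Option V // w ≠ none} :=
  Equiv.ofBijective (fun x => ⟨some x, Option.some_ne_none x⟩) <| by
    constructor
    · intro x y h
      simpa using h
    · rintro ⟨_ | x, hx⟩
      · exact absurd rfl hx
      · exact ⟨x, rfl⟩

theorem moveEquiv_removeSource (D : V → V → ℕ∞) (b : V → ℕ∞) (hb : ∀ y, b y ≠ ⊤)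
    (hb0 : ∃ y, b y ≠ 0) : MoveEquiv (ofAdj (extend D 0 b 0)) (ofAdj D) := by
  have hsrc : (ofAdj (extend D 0 b 0)).IsSource none := by
    rintro ⟨_ | x, y, k, hk⟩ (rfl : y = none)
    · exact not_lt_zero hk
    · exact not_lt_zero hk
  refine MoveEquiv.moveS (inferInstanceAs (Finite (Option V))) none
    (regular_ofAdj _ _ ?_ ?_) hsrc ?_
  · rintro (_ | y)
    · exact ENat.zero_ne_top
    · exact hb y
  · obtain ⟨y, hy⟩ := hb0
    exact ⟨some y, hy⟩
  · have : Countable ((ofAdj (extend D 0 b 0)).removeSource none hsrc).E :=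
      inferInstanceAs (Countable {e : (ofAdj (extend D 0 b 0)).E // e.1 ≠ none})
    refine nonempty_iso_of_adj' (G := (ofAdj (extend D 0 b 0)).removeSource none hsrc)
      (someEquiv V) fun x y => ?_
    rw [adj_ofAdj]
    refine Eq.trans ?_ (adj_ofAdj (extend D 0 b 0) (some x) (some y))
    refine ENat.card_congr
      { toFun := fun e => ⟨e.1.1, congrArg Subtype.val e.2.1, congrArg Subtype.val e.2.2⟩
        invFun := fun e => ⟨⟨e.1, fun h => Option.some_ne_none x (e.2.1.symm.trans h)⟩,
          Subtype.ext e.2.1, Subtype.ext e.2.2⟩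
        left_inv := fun e => rfl
        right_inv := fun e => rfl }

theorem moveEquiv_reduce [DecidableEq V] (D : V → V → ℕ∞) (a : V → ℕ∞) (x₀ y₀ : V)
    (ha : ∀ x, x ≠ x₀ → a x = 0) :
    MoveEquiv (ofAdj (extend D a (Pi.single y₀ 1) 0))
      (ofAdj fun x y => D x y + a x * (Pi.single y₀ 1 : V → ℕ∞) y) := by
  let A := extend D a (Pi.single y₀ 1) 0
  let f : (ofAdj A).E := ⟨none, some y₀, 0, by simp [A, extend]⟩
  have honly : ∀ e : (ofAdj A).E, e.1 = none → e = f := by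
    rintro ⟨x, _ | y, k, hk⟩ (rfl : x = none)
    · exact absurd hk not_lt_zero
    · by_cases h : y = y₀
      · subst h
        have : k = 0 := by simpa [A, extend] using hk
        subst this
        rfl
      · simp [A, extend, h] at hk
  have hin : ∀ e : (ofAdj A).E, e.2.1 = none → e.1 = some x₀ := by
    rintro ⟨_ | x, y, k, hk⟩ (rfl : y = none)
    · exact absurd hk not_lt_zero
    · by_cases h : x = x₀
      · exact congrArg some h
      · simp [A, extend, ha x h] at hk
  have hrf : (ofAdj A).r f ≠ none := Option.some_ne_none y₀
  refine MoveEquiv.moveR (inferInstanceAs (Finite (Option V))) none f rfl hrf honly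
    (some x₀) hin ?_
  have : Countable ((ofAdj A).reduce none f rfl hrf honly (some x₀) hin).E :=
    inferInstanceAs (Countable ({e : (ofAdj A).E // e.2.1 ≠ none ∧ e ≠ f} ⊕
      {e : (ofAdj A).E // e.2.1 = none}))
  refine nonempty_iso_of_adj' (G := (ofAdj A).reduce none f rfl hrf honly (some x₀) hin)
    (someEquiv V) fun x y => ?_
  rw [adj_ofAdj]
  refine (ENat.card_congr (Equiv.subtypeSum (α := {e : (ofAdj A).E // e.2.1 ≠ none ∧ e ≠ f})
    (β := {e : (ofAdj A).E // e.2.1 = none}))).trans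
      ((ENat.card_sum _ _).trans (congrArg₂ (· + ·) ?_ ?_))
  · refine Eq.trans ?_ (adj_ofAdj A (some x) (some y))
    refine ENat.card_congr
      { toFun := fun e => ⟨e.1.1, congrArg Subtype.val e.2.1, congrArg Subtype.val e.2.2⟩
        invFun := fun e => ⟨⟨e.1, fun h => Option.some_ne_none y (e.2.2.symm.trans h), ?_⟩,
          Subtype.ext e.2.1, Subtype.ext e.2.2⟩
        left_inv := fun e => rfl
        right_inv := fun e => rfl }
    rintro h
    have := e.2.1
    rw [h] at this
    exact Option.some_ne_none x this.symm
  · by_cases h : y = y₀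
    · have hs : (Pi.single y₀ 1 : V → ℕ∞) y = 1 := by rw [h, Pi.single_eq_same]
      rw [hs, mul_one]
      refine Eq.trans ?_ (adj_ofAdj A (some x) none)
      exact ENat.card_congr
        { toFun := fun e => ⟨e.1.1, congrArg Subtype.val e.2.1, e.1.2⟩
          invFun := fun e => ⟨⟨e.1, e.2.2⟩, Subtype.ext e.2.1,
            Subtype.ext (congrArg some h.symm)⟩
          left_inv := fun e => rfl
          right_inv := fun e => rfl }
    · rw [Pi.single_eq_of_ne h, mul_zero, ENat.card_eq_zero_iff_empty]
      refine ⟨fun e => h ?_⟩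
      exact (Option.some_injective _ (congrArg Subtype.val e.2.2)).symm

theorem moveEquiv_collapse_of_single_out [DecidableEq V] (y₀ : V) (D : V → V → ℕ∞)
    (a : V → ℕ∞) :
    MoveEquiv (ofAdj (extend D a (Pi.single y₀ 1) 0))
      (ofAdj fun x y => D x y + a x * (Pi.single y₀ 1 : V → ℕ∞) y) := by
  have := Fintype.ofFinite V
  suffices h : ∀ s : Finset V, ∀ (D : V → V → ℕ∞) (a : V → ℕ∞), (∀ x ∉ s, a x = 0) →
      MoveEquiv (ofAdj (extend D a (Pi.single y₀ 1) 0))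
        (ofAdj fun x y => D x y + a x * (Pi.single y₀ 1 : V → ℕ∞) y) from
    h Finset.univ D a fun x hx => absurd (Finset.mem_univ x) hx
  have hb : ∀ y, (Pi.single y₀ 1 : V → ℕ∞) y ≠ ⊤ := fun y => by
    by_cases h : y = y₀ <;> simp [h]
  have hb0 : ∃ y, (Pi.single y₀ 1 : V → ℕ∞) y ≠ 0 := ⟨y₀, by simp⟩
  intro s
  induction s using Finset.induction_on with
  | empty =>
    intro D a ha
    obtain rfl : a = 0 := funext fun x => ha x (Finset.notMem_empty x)
    simpa using moveEquiv_removeSource D (Pi.single y₀ 1) hb hb0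
  | insert k s hk ih =>
    intro D a ha
    have ha' : ∀ x ∉ s, Function.update a k 0 x = 0 := by
      intro x hx
      by_cases h : x = k
      · simp [h]
      · simpa [h] using ha x (by simp [h, hx])
    have hsum : ∀ x, a x = (Pi.single k (a k) : V → ℕ∞) x + Function.update a k 0 x := by
      intro x
      by_cases h : x = k
      · subst h; simp
      · simp [h]
    by_cases hak : a k = 0
    · refine ih D a fun x hx => ?_
      rw [hsum, ha' x hx]
      by_cases h : x = k <;> simp [h, hak]
    by_cases ha0 : ∃ x, Function.update a k 0 x ≠ 0
    · refine MoveEquiv.trans (moveEquiv_inSplit _ (extend D (Function.update a k 0)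
        (Pi.single y₀ 1) 0) none (fun x => x.elim 0 (Pi.single k (a k))) ?_ ?_ ?_ ?_ ?_ ?_ ?_) ?_
      · rintro (_ | x) (_ | y) h
        exacts [absurd rfl h, rfl, absurd rfl h, rfl]
      · rintro (_ | x)
        · exact (add_zero 0).symm
        · exact hsum x
      · rintro (_ | x) h
        · rfl
        · by_cases hx : x = k
          · simp [extend, hx]
          · simp [hx] at h
      · exact ⟨some k, by simpa using hak⟩
      · obtain ⟨x, hx⟩ := ha0
        exact ⟨some x, hx⟩
      · rintro (_ | y)
        · exact ENat.zero_ne_top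
        · exact hb y
      · exact ⟨some y₀, by simp [extend]⟩
      · have hrow : (fun y => extend D (Function.update a k 0) (Pi.single y₀ 1) 0 none y) =
            Pi.single (some y₀) 1 := by
          funext y
          rcases y with _ | y
          · simp [extend]
          · simp [extend, Pi.single_apply]
        rw [hrow]
        refine MoveEquiv.trans (moveEquiv_reduce _ _ (some k) (some y₀) ?_) ?_
        · rintro (_ | x) hx
          · rfl
          · have : x ≠ k := fun h => hx (congrArg some h)
            simp [this]
        · convert ih (fun x y => D x y +
            (Pi.single k (a k) : V → ℕ∞) x * (Pi.single y₀ 1 : V → ℕ∞) y) _ ha' using 2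
          · funext x y
            rcases x with _ | x <;> rcases y with _ | y <;> simp [extend, Pi.single_apply]
          · funext x y
            rw [hsum x, add_mul, add_assoc]
    · push Not at ha0
      refine moveEquiv_reduce D a k y₀ fun x hx => ?_
      rw [hsum, ha0]
      simp [hx]

theorem moveEquiv_collapse_of_single_in [DecidableEq V] (x₀ : V) (D : V → V → ℕ∞)
    (s : Multiset V) (hs : s ≠ 0) :
    MoveEquiv (ofAdj (extend D (Pi.single x₀ 1) (fun y => (s.count y : ℕ∞)) 0))
      (ofAdj fun x y => D x y + (Pi.single x₀ 1 : V → ℕ∞) x * (s.count y : ℕ∞)) := by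
  induction s using Multiset.induction_on generalizing D with
  | empty => exact absurd rfl hs
  | cons k s ih =>
    have hsum : ∀ y, ((Multiset.count y (k ::ₘ s) : ℕ) : ℕ∞) =
        (Pi.single k 1 : V → ℕ∞) y + (s.count y : ℕ∞) := by
      intro y
      rw [Multiset.count_cons, add_comm]
      by_cases h : y = k <;> simp [h]
    by_cases hs0 : s = 0
    · have h : (fun y => ((Multiset.count y (k ::ₘ s) : ℕ) : ℕ∞)) = Pi.single k 1 := by
        funext y
        rw [hsum, hs0]
        simp
      rw [h]
      simp only [congrFun h]
      exact moveEquiv_reduce D _ x₀ k fun x hx => by simp [hx]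
    · refine MoveEquiv.trans (moveEquiv_outSplit _ (extend D (Pi.single x₀ 1)
        (fun y => (s.count y : ℕ∞)) 0) none (fun x => x.elim 0 (Pi.single k 1)) ?_ ?_ ?_ ?_ ?_) ?_
      · rintro (_ | x) (_ | y) h
        exacts [absurd rfl h, absurd rfl h, rfl, rfl]
      · rintro (_ | y)
        · exact (add_zero 0).symm
        · exact hsum y
      · rintro (_ | y)
        · exact ENat.zero_ne_top
        · by_cases h : y = k <;> simp [h]
      · exact ⟨some k, by simp⟩
      · obtain ⟨y, hy⟩ := Multiset.exists_mem_of_ne_zero hs0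
        exact ⟨some y, by simpa [extend] using hy⟩
      · have hrow : (fun y : Option V => y.elim 0 (Pi.single k 1 : V → ℕ∞)) =
            Pi.single (some k) 1 := by
          funext y
          rcases y with _ | y
          · simp
          · simp [Pi.single_apply]
        have hcol : (fun x => extend D (Pi.single x₀ 1) (fun y => (s.count y : ℕ∞)) 0 x none) =
            Pi.single (some x₀) 1 := by
          funext x
          rcases x with _ | x
          · simp [extend]
          · simp [extend, Pi.single_apply]
        rw [hrow, hcol]
        refine MoveEquiv.trans (moveEquiv_reduce _ _ (some x₀) (some k) ?_) ?_
        · intro x hx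
          simp [hx]
        · convert ih (fun x y => D x y +
            (Pi.single x₀ 1 : V → ℕ∞) x * (Pi.single k 1 : V → ℕ∞) y) hs0 using 2
          · funext x y
            rcases x with _ | x <;> rcases y with _ | y <;> simp [extend, Pi.single_apply]
          · funext x y
            rw [hsum y, mul_add, add_assoc]

theorem moveEquiv_add_column [DecidableEq V] (A D : V → V → ℕ∞) {i j : V} (hij : i ≠ j)
    (hA : ∀ x y, A x y =
      (Pi.single j 1 : V → ℕ∞) x * (Pi.single i 1 : V → ℕ∞) y + D x y)
    (hD : ∃ y, D j y ≠ 0) :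
    MoveEquiv (ofAdj A) (ofAdj fun x y => D x y + D x j * (Pi.single i 1 : V → ℕ∞) y) := by
  refine MoveEquiv.trans (moveEquiv_outSplit A D j (Pi.single i 1) ?_ ?_ ?_ ?_ hD) ?_
  · intro x y hx
    simp [hA, hx]
  · intro y
    simp [hA]
  · intro y
    by_cases h : y = i <;> simp [h]
  · exact ⟨i, by simp⟩
  · rw [Pi.single_eq_of_ne hij.symm]
    exact moveEquiv_collapse_of_single_out i D fun x => D x j

theorem moveEquiv_add_row [DecidableEq V] (A D : V → V → ℕ∞) {i j : V} (hij : i ≠ j)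
    (hA : ∀ x y, A x y =
      (Pi.single i 1 : V → ℕ∞) x * (Pi.single j 1 : V → ℕ∞) y + D x y)
    (hD : D j j ≠ 0) (hfin : ∀ y, D j y ≠ ⊤) :
    MoveEquiv (ofAdj A) (ofAdj fun x y => D x y + (Pi.single i 1 : V → ℕ∞) x * D j y) := by
  have hAj : ∀ y, A j y = D j y := fun y => by simp [hA, hij.symm]
  refine MoveEquiv.trans (moveEquiv_inSplit A D j (Pi.single i 1) ?_ ?_ ?_ ?_ ⟨j, hD⟩ ?_ ?_) ?_
  · intro x y hy
    simp [hA, hy]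
  · intro x
    simp [hA]
  · intro x hx
    by_cases h : x = i <;> simp [h] at hx
  · exact ⟨i, by simp⟩
  · exact fun y => (hAj y).symm ▸ hfin y
  · exact ⟨j, (hAj j).symm ▸ hD⟩
  · rw [Pi.single_eq_of_ne hij.symm]
    let s : Multiset V :=
      Finsupp.toMultiset (Finsupp.equivFunOnFinite.symm fun y => (D j y).toNat)
    have hs : ∀ y, D j y = (s.count y : ℕ∞) := fun y => by
      simp [s, Finsupp.count_toMultiset, ENat.natCast_toNat (hfin y)]
    have hs0 : s ≠ 0 := by
      intro h
      rw [hs, h] at hD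
      simp at hD
    simp only [hs]
    exact moveEquiv_collapse_of_single_in i D s hs0

end

section matrices

variable {n m : ℕ}

theorem Jmat_add_apply_of_lt (B : Matrix (Fin n) (Fin n) ℕ) {x : Fin n} (hx : x.1 < m)
    (y : Fin n) :
    (Jmat n m + B.map ((↑) : ℕ → ℕ∞)) x y = (((if x = y then 1 else 0) + B x y : ℕ) : ℕ∞) := by
  simp [Jmat, hx]

theorem Jmat_add_apply_of_ge (B : Matrix (Fin n) (Fin n) ℕ) {x : Fin n} (hx : m ≤ x.1)
    (y : Fin n) : (Jmat n m + B.map ((↑) : ℕ → ℕ∞)) x y = ⊤ := by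
  simp [Jmat, not_lt.2 hx]

/-- The matrix obtained from `B` by adding column `j` to column `i`. -/
def addColumn (B : Matrix (Fin n) (Fin n) ℕ) (i j : Fin n) : Matrix (Fin n) (Fin n) ℕ :=
  Matrix.of fun k l => if l = i then B k i + B k j else B k l

/-- The matrix obtained from `B` by adding row `j` to row `i`. -/
def addRow (B : Matrix (Fin n) (Fin n) ℕ) (i j : Fin n) : Matrix (Fin n) (Fin n) ℕ :=
  Matrix.of fun k l => if k = i then B i l + B j l else B k l

theorem matMoveEquiv_addColumn_of_ne_zero (B : Matrix (Fin n) (Fin n) ℕ) {i j : Fin n}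
    (hij : i ≠ j) (h : (Jmat n m + B.map ((↑) : ℕ → ℕ∞)) j i ≠ 0) :
    MatMoveEquiv (Jmat n m + B.map ((↑) : ℕ → ℕ∞))
      (Jmat n m + (addColumn B i j).map ((↑) : ℕ → ℕ∞)) := by
  let D : Fin n → Fin n → ℕ∞ := fun x y =>
    (Jmat n m + B.map ((↑) : ℕ → ℕ∞)) x y - if x = j ∧ y = i then 1 else 0
  have hA : ∀ x y, (Jmat n m + B.map ((↑) : ℕ → ℕ∞)) x y =
      (Pi.single j 1 : Fin n → ℕ∞) x * (Pi.single i 1 : Fin n → ℕ∞) y + D x y := by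
    intro x y
    by_cases hx : x = j <;> by_cases hy : y = i
    · subst hx hy
      simp only [D, Pi.single_eq_same, mul_one, and_self, if_true]
      exact (add_tsub_cancel_of_le (Order.one_le_iff_ne_zero.2 h)).symm
    all_goals simp [D, hx, hy]
  have hjj : D j j ≠ 0 := by
    rcases lt_or_ge j.1 m with hj | hj
    · simp only [D]
      rw [Jmat_add_apply_of_lt _ hj]
      simp [hij.symm]
    · simp only [D]
      rw [Jmat_add_apply_of_ge _ hj]
      simp [hij.symm]
  refine MoveEquiv.trans (moveEquiv_add_column (V := Fin n) _ D hij hA ⟨j, hjj⟩) ?_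
  have : (fun x y => D x y + D x j * (Pi.single i 1 : Fin n → ℕ∞) y) =
      Jmat n m + (addColumn B i j).map ((↑) : ℕ → ℕ∞) := by
    funext x y
    rcases lt_or_ge x.1 m with hx | hx
    · simp only [D]
      rw [Jmat_add_apply_of_lt _ hx, Jmat_add_apply_of_lt _ hx, Jmat_add_apply_of_lt _ hx]
      by_cases hy : y = i
      · subst hy
        by_cases hxj : x = j
        · subst hxj
          rw [Jmat_add_apply_of_lt _ hx] at h
          have h' : B x y ≠ 0 := by simpa [hij.symm] using h
          simp only [addColumn, Matrix.of_apply, Pi.single_eq_same, mul_one]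
          simp only [hij.symm, and_self, and_false, if_true, if_false]
          norm_cast
          simp only [tsub_zero]
          omega
        · simp [hxj, addColumn, add_assoc]
      · simp [hy, addColumn]
    · simp only [D]
      rw [Jmat_add_apply_of_ge _ hx, Jmat_add_apply_of_ge _ hx, Jmat_add_apply_of_ge _ hx]
      by_cases hh : x = j ∧ y = i <;> simp [hh]
  rw [this]
  exact MoveEquiv.of_iso (inferInstanceAs (Finite (Fin n)))
    ⟨⟨Equiv.refl _, Equiv.refl _, fun _ => rfl, fun _ => rfl⟩⟩

theorem matMoveEquiv_addRow_of_ne_zero (B : Matrix (Fin n) (Fin n) ℕ) {i j : Fin n}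
    (hij : i ≠ j) (hi : i.1 < m) (hj : j.1 < m) (h : B i j ≠ 0) :
    MatMoveEquiv (Jmat n m + B.map ((↑) : ℕ → ℕ∞))
      (Jmat n m + (addRow B i j).map ((↑) : ℕ → ℕ∞)) := by
  let D : Fin n → Fin n → ℕ∞ := fun x y =>
    (Jmat n m + B.map ((↑) : ℕ → ℕ∞)) x y - if x = i ∧ y = j then 1 else 0
  have hA : ∀ x y, (Jmat n m + B.map ((↑) : ℕ → ℕ∞)) x y =
      (Pi.single i 1 : Fin n → ℕ∞) x * (Pi.single j 1 : Fin n → ℕ∞) y + D x y := by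
    intro x y
    by_cases hx : x = i <;> by_cases hy : y = j
    · subst hx hy
      simp only [D, Pi.single_eq_same, mul_one, and_self, if_true]
      refine (add_tsub_cancel_of_le (Order.one_le_iff_ne_zero.2 ?_)).symm
      simp [Jmat_add_apply_of_lt _ hi, h]
    all_goals simp [D, hx, hy]
  have hDj : ∀ y, D j y = (((if j = y then 1 else 0) + B j y : ℕ) : ℕ∞) := fun y => by
    simp only [D]
    rw [Jmat_add_apply_of_lt _ hj]
    simp [hij.symm]
  have : (fun x y => D x y + (Pi.single i 1 : Fin n → ℕ∞) x * D j y) =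
      Jmat n m + (addRow B i j).map ((↑) : ℕ → ℕ∞) := by
    funext x y
    rw [hDj]
    by_cases hx : x = i
    · subst hx
      simp only [D]
      rw [Jmat_add_apply_of_lt _ hi, Jmat_add_apply_of_lt _ hi]
      simp only [Pi.single_eq_same, one_mul, addRow, Matrix.of_apply, if_true, true_and]
      by_cases hy : y = j
      · subst hy
        simp only [hij, if_true, if_false]
        norm_cast
        omega
      · have hy' : j ≠ y := fun h => hy h.symm
        simp only [hy, hy', if_false]
        norm_cast
        simp only [tsub_zero]
        omega
    · simp [D, hx, addRow]
  rw [← this]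
  refine moveEquiv_add_row (V := Fin n) _ D hij hA ?_ fun y => ?_
  · simp [hDj]
  · rw [hDj]
    exact ENat.natCast_ne_top _

theorem le_addColumn (B : Matrix (Fin n) (Fin n) ℕ) (i j x y : Fin n) :
    B x y ≤ addColumn B i j x y := by
  by_cases h : y = i <;> simp [addColumn, h]

theorem le_addRow (B : Matrix (Fin n) (Fin n) ℕ) (i j x y : Fin n) :
    B x y ≤ addRow B i j x y := by
  by_cases h : x = i <;> simp [addRow, h]

theorem matMoveEquiv_addColumn {B₀ : Matrix (Fin n) (Fin n) ℕ} {i j : Fin n}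
    (hpath : Relation.ReflTransGen
      (fun x y => (Jmat n m + B₀.map ((↑) : ℕ → ℕ∞)) x y ≠ 0) j i)
    (B : Matrix (Fin n) (Fin n) ℕ) (hB : ∀ x y, B₀ x y ≤ B x y) (hij : i ≠ j) :
    MatMoveEquiv (Jmat n m + B.map ((↑) : ℕ → ℕ∞))
      (Jmat n m + (addColumn B i j).map ((↑) : ℕ → ℕ∞)) := by
  have hmono : ∀ {C C' : Matrix (Fin n) (Fin n) ℕ}, (∀ x y, C x y ≤ C' x y) → ∀ {x y},
      (Jmat n m + C.map ((↑) : ℕ → ℕ∞)) x y ≠ 0 →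
        (Jmat n m + C'.map ((↑) : ℕ → ℕ∞)) x y ≠ 0 := by
    intro C C' hC x y h
    rw [← pos_iff_ne_zero] at h ⊢
    exact h.trans_le (add_le_add_right (Nat.cast_le.2 (hC x y)) _)
  induction hpath using Relation.ReflTransGen.head_induction_on generalizing B with
  | refl => exact absurd rfl hij
  | @head j k hjk hki ih =>
    by_cases hji : (Jmat n m + B.map ((↑) : ℕ → ℕ∞)) j i ≠ 0
    · exact matMoveEquiv_addColumn_of_ne_zero B hij hji
    have hki' : i ≠ k := by
      rintro rfl
      exact hji (hmono hB hjk)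
    by_cases hkj : k = j
    · subst hkj
      exact ih B hB hij
    have hjm : j.1 < m := by
      by_contra hjm
      exact hji (by simp [Jmat_add_apply_of_ge _ (not_lt.1 hjm)])
    have hjk' : (Jmat n m + B.map ((↑) : ℕ → ℕ∞)) j k ≠ 0 := hmono hB hjk
    have hBjk : B j k ≠ 0 := by
      rw [Jmat_add_apply_of_lt _ hjm] at hjk'
      simpa [Ne.symm hkj] using hjk'
    have h1 := ih B hB hki'
    have h2 : MatMoveEquiv (Jmat n m + (addColumn B i k).map ((↑) : ℕ → ℕ∞))
        (Jmat n m + (addColumn (addColumn B i k) i j).map ((↑) : ℕ → ℕ∞)) := by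
      refine matMoveEquiv_addColumn_of_ne_zero _ hij ?_
      rw [Jmat_add_apply_of_lt _ hjm]
      simp [addColumn, hBjk]
    have h3 := ih (addColumn B i j) (fun x y => (hB x y).trans (le_addColumn B i j x y)) hki'
    have hcomm : addColumn (addColumn B i k) i j = addColumn (addColumn B i j) i k := by
      ext x y
      by_cases hy : y = i
      · simp [addColumn, hy, hki'.symm, hij.symm, add_right_comm]
      · simp [addColumn, hy]
    rw [hcomm] at h2
    exact (h1.trans h2).trans h3.symm

theorem matMoveEquiv_addRow {B₀ : Matrix (Fin n) (Fin n) ℕ} {i j : Fin n}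
    (hpath : Relation.ReflTransGen
      (fun x y => x.1 < m ∧ y.1 < m ∧ (x = y ∨ B₀ x y ≠ 0)) i j)
    (B : Matrix (Fin n) (Fin n) ℕ) (hB : ∀ x y, B₀ x y ≤ B x y) (hij : i ≠ j)
    (hi : i.1 < m) :
    MatMoveEquiv (Jmat n m + B.map ((↑) : ℕ → ℕ∞))
      (Jmat n m + (addRow B i j).map ((↑) : ℕ → ℕ∞)) := by
  induction hpath generalizing B with
  | refl => exact absurd rfl hij
  | @tail k j hik hkj ih =>
    obtain ⟨hk, hj, rfl | hkj⟩ := hkj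
    · exact ih B hB hij
    have hBkj : B k j ≠ 0 := fun h => hkj (Nat.le_zero.1 (h ▸ hB k j))
    by_cases hik' : i = k
    · subst hik'
      exact matMoveEquiv_addRow_of_ne_zero B hij hi hj hBkj
    have h1 := ih B hB hik'
    have h2 : MatMoveEquiv (Jmat n m + (addRow B i k).map ((↑) : ℕ → ℕ∞))
        (Jmat n m + (addRow (addRow B i k) i j).map ((↑) : ℕ → ℕ∞)) :=
      matMoveEquiv_addRow_of_ne_zero _ hij hi hj (by simp [addRow, hBkj])
    have h3 := ih (addRow B i j) (fun x y => (hB x y).trans (le_addRow B i j x y)) hik'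
    have hcomm : addRow (addRow B i k) i j = addRow (addRow B i j) i k := by
      ext x y
      by_cases hx : x = i
      · simp [addRow, hx, Ne.symm hik', hij.symm, add_right_comm]
      · simp [addRow, hx]
    rw [hcomm] at h2
    exact (h1.trans h2).trans h3.symm

theorem reflTransGen_of_matIrreducible {k : ℕ} {A : Matrix (Fin k) (Fin k) ℕ∞}
    (hA : MatIrreducible A) (i j : Fin k) :
    Relation.ReflTransGen (fun x y => A x y ≠ 0) i j := by
  obtain ⟨l, c, -, rfl, rfl, hc⟩ := hA i j
  clear hA
  induction l with
  | zero => exact Relation.ReflTransGen.refl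
  | succ l ih =>
    exact (ih fun t ht => hc t (ht.trans l.lt_succ_self)).tail (hc l l.lt_succ_self)

end matrices

end CKGraph

/-- row and column additions on `B` preserve the move-equivalence class
of `J_{nm} + B`. -/
theorem stmt9 {n m : ℕ} (hmn : m ≤ n) (B B' : Matrix (Fin n) (Fin n) ℕ)
    (hzero : ∀ i : Fin n, m ≤ i.1 → ∀ j, B i j = 0)
    (hirr : MatIrreducible (Jmat n m + B.map ((↑) : ℕ → ℕ∞)))
    (hcorner : MatIrreducible
      ((Jmat n m + B.map ((↑) : ℕ → ℕ∞)).submatrix (Fin.castLE hmn) (Fin.castLE hmn)))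
    (hB' : (∃ i j : Fin n, i ≠ j ∧
        B' = Matrix.of fun k l => if l = i then B k i + B k j else B k l) ∨
      (∃ i j : Fin n, i ≠ j ∧ (∃ l, B i l ≠ 0) ∧ (∃ l, B j l ≠ 0) ∧
        B' = Matrix.of fun k l => if k = i then B i l + B j l else B k l)) :
    MatMoveEquiv (Jmat n m + B.map ((↑) : ℕ → ℕ∞))
      (Jmat n m + B'.map ((↑) : ℕ → ℕ∞)) := by
  rcases hB' with ⟨i, j, hij, rfl⟩ | ⟨i, j, hij, ⟨p, hp⟩, ⟨q, hq⟩, rfl⟩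
  · exact CKGraph.matMoveEquiv_addColumn (CKGraph.reflTransGen_of_matIrreducible hirr j i) B
      (fun _ _ => le_rfl) hij
  · have hi : i.1 < m := not_le.1 fun h => hp (hzero i h p)
    have hj : j.1 < m := not_le.1 fun h => hq (hzero j h q)
    refine CKGraph.matMoveEquiv_addRow (B₀ := B) ?_ B (fun _ _ => le_rfl) hij hi
    refine Relation.ReflTransGen.lift (Fin.castLE hmn) ?_ _ _
      (CKGraph.reflTransGen_of_matIrreducible hcorner ⟨i, hi⟩ ⟨j, hj⟩)
    intro x y hxy
    refine ⟨x.2, y.2, or_iff_not_imp_left.2 fun hne h => hxy ?_⟩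
    rw [Matrix.submatrix_apply, CKGraph.Jmat_add_apply_of_lt (x := Fin.castLE hmn x) B x.2,
      if_neg hne, h]
    rfl
end
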